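/- Fix λ > 1, r > 0 and T > 0. There exist a probability space (Ω', F', P') and a jointly measurable map X : Ω' × [0,T] → ℝ^{ℕ≥1} such that: (i) the law on ℝ^{ℕ≥1} of ω ↦ (X_n(ω,0))_{n≥1} is the infinite product Gaussian measure μ_r = ⊗_{n≥1} N(0,r²); and (ii) for P'-almost every ω, each X_n(ω,·) is continuous on [0,T] and (X_n(ω,·))_{n≥1} is a componentwise solution of the infinite mixed shell model with initial condition (X_n(ω,0))_{n≥1}; i.e. (Ω', F', P', X) is a random solution of the infinite shell model. -/

import Mathlib

open MeasureTheory ProbabilityTheory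

/-- Coefficients of the infinite mixed shell model: `k n = λ ^ n` for `n ≥ 2`,
`k 0 = k 1 = 0`. -/
noncomputable def mixedK (lam : ℝ) (n : ℕ) : ℝ :=
  if 2 ≤ n then lam ^ n else 0

/-- A componentwise solution of the infinite mixed shell model on `[0,T]` with initial
condition `x̄` (components indexed by `n ≥ 1`, convention `X_0 ≡ 0`). -/
def IsCwShellSolution (lam T : ℝ) (xbar : ℕ → ℝ) (X : ℕ → ℝ → ℝ) : Prop :=
  (∀ t, X 0 t = 0) ∧
  ∀ n, 1 ≤ n →
    ContinuousOn (X n) (Set.Icc (0 : ℝ) T) ∧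
    ∀ t ∈ Set.Icc (0 : ℝ) T,
      X n t = xbar n + ∫ s in (0 : ℝ)..t,
        (mixedK lam n * (X (n - 1) s) ^ 2
          - mixedK lam (n + 1) * X n s * X (n + 1) s
          - mixedK lam n * (X (n + 1) s) ^ 2
          + mixedK lam (n - 1) * X (n - 1) s * X n s)

/-- Law of a sequence of independent centered Gaussian variables with variance `v`. -/
noncomputable def gaussianSeq (v : NNReal) : Measure (ℕ → ℝ) :=
  Measure.infinitePi fun _ : ℕ => gaussianReal 0 v

instance (v : NNReal) : IsProbabilityMeasure (gaussianSeq v) := by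
  unfold gaussianSeq; infer_instance

theorem measurePreserving_gaussianSeq_update (v : NNReal) (i : ℕ) :
    MeasurePreserving (fun p : (ℕ → ℝ) × ℝ => Function.update p.1 i p.2)
      ((gaussianSeq v).prod (gaussianReal 0 v)) (gaussianSeq v) := by
  classical
  have hm : Measurable (fun p : (ℕ → ℝ) × ℝ => Function.update p.1 i p.2) := by
    refine measurable_pi_lambda _ fun n => ?_
    by_cases h : n = i
    · subst h; simpa using measurable_snd
    · simp only [Function.update_of_ne h]
      fun_prop
  refine ⟨hm, ?_⟩
  refine Measure.eq_infinitePi _ fun s t ht => ?_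
  rw [Measure.map_apply hm (MeasurableSet.pi s.countable_toSet fun i _ => ht i)]
  by_cases his : i ∈ s
  · have : (fun p : (ℕ → ℝ) × ℝ => Function.update p.1 i p.2) ⁻¹' (Set.pi s t)
        = (Set.pi (s.erase i : Finset ℕ) t) ×ˢ t i := by
      ext p
      simp only [Set.mem_preimage, Set.mem_pi, Finset.mem_coe, Set.mem_prod, Finset.mem_erase]
      constructor
      · intro h
        refine ⟨fun n hn => ?_, by simpa using h i his⟩
        simpa [Function.update_of_ne hn.1] using h n hn.2
      · rintro ⟨h1, h2⟩ n hn
        by_cases hni : n = i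
        · subst hni; simpa using h2
        · simpa [Function.update_of_ne hni] using h1 n ⟨hni, hn⟩
    rw [this, Measure.prod_prod, gaussianSeq, Measure.infinitePi_pi _ fun i _ => ht i,
      Finset.prod_erase_mul _ _ his]
  · have : (fun p : (ℕ → ℝ) × ℝ => Function.update p.1 i p.2) ⁻¹' (Set.pi s t)
        = (Set.pi (s : Set ℕ) t) ×ˢ Set.univ := by
      ext p
      simp only [Set.mem_preimage, Set.mem_pi, Finset.mem_coe, Set.mem_prod, Set.mem_univ,
        and_true]
      refine forall₂_congr fun n hn => ?_
      rw [Function.update_of_ne (fun h : n = i => his (h ▸ hn))]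
    rw [this, Measure.prod_prod, gaussianSeq, Measure.infinitePi_pi _ fun i _ => ht i,
      measure_univ, mul_one]

/-- Rotation of the coordinates `i` and `j` by the angle `θ x`. -/
noncomputable def coordRotation (i j : ℕ) (θ : (ℕ → ℝ) → ℝ) (x : ℕ → ℝ) : ℕ → ℝ :=
  fun n => if n = i then Real.cos (θ x) * x i + Real.sin (θ x) * x j
    else if n = j then -Real.sin (θ x) * x i + Real.cos (θ x) * x j else x n

theorem continuous_coordRotation (i j : ℕ) {θ : (ℕ → ℝ) → ℝ} (hθ : Continuous θ) :
    Continuous (coordRotation i j θ) := by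
  unfold coordRotation
  refine continuous_pi fun n => ?_
  split_ifs <;> fun_prop

theorem gaussianReal_prod_map_rotation (v : NNReal) (a : ℝ) :
    ((gaussianReal 0 v).prod (gaussianReal 0 v)).map
      (fun p : ℝ × ℝ => (Real.cos a * p.1 + Real.sin a * p.2,
        -Real.sin a * p.1 + Real.cos a * p.2))
      = (gaussianReal 0 v).prod (gaussianReal 0 v) := by
  have h := IsGaussian.map_rotation_eq_self (μ := gaussianReal 0 v) (by simp) a
  exact h

theorem measurePreserving_coordRotation (v : NNReal) {i j : ℕ} (hij : i ≠ j)
    {θ : (ℕ → ℝ) → ℝ} (hθ : Continuous θ)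
    (hinv : ∀ x a b, θ (Function.update (Function.update x i a) j b) = θ x) :
    MeasurePreserving (coordRotation i j θ) (gaussianSeq v) (gaussianSeq v) := by
  classical
  set γ := gaussianReal 0 v
  set U : (ℕ → ℝ) × (ℝ × ℝ) → (ℕ → ℝ) :=
    fun p => Function.update (Function.update p.1 i p.2.1) j p.2.2 with hU
  have hUmp : MeasurePreserving U ((gaussianSeq v).prod (γ.prod γ)) (gaussianSeq v) := by
    have h1 := (measurePreserving_gaussianSeq_update v i).prod (MeasurePreserving.id γ)
    have h2 := (measurePreserving_gaussianSeq_update v j).comp h1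
    have h3 : MeasurePreserving (MeasurableEquiv.prodAssoc (α := ℕ → ℝ) (β := ℝ) (γ := ℝ))
      (((gaussianSeq v).prod γ).prod γ) ((gaussianSeq v).prod (γ.prod γ)) :=
      measurePreserving_prodAssoc _ _ _
    exact h2.comp h3.symm
  set W : (ℕ → ℝ) × (ℝ × ℝ) → (ℕ → ℝ) × (ℝ × ℝ) := fun p =>
    (p.1, (Real.cos (θ p.1) * p.2.1 + Real.sin (θ p.1) * p.2.2,
      -Real.sin (θ p.1) * p.2.1 + Real.cos (θ p.1) * p.2.2)) with hW
  have hWmp : MeasurePreserving W ((gaussianSeq v).prod (γ.prod γ))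
      ((gaussianSeq v).prod (γ.prod γ)) := by
    refine (MeasurePreserving.id (gaussianSeq v)).skew_product
      (g := fun (x : ℕ → ℝ) (p : ℝ × ℝ) => (Real.cos (θ x) * p.1 + Real.sin (θ x) * p.2,
        -Real.sin (θ x) * p.1 + Real.cos (θ x) * p.2)) ?_ ?_
    · have := hθ.measurable
      unfold Function.uncurry
      fun_prop
    · exact Filter.Eventually.of_forall fun x => gaussianReal_prod_map_rotation v (θ x)
  have hcomm : coordRotation i j θ ∘ U = U ∘ W := by
    funext p
    funext n
    simp only [Function.comp, coordRotation, hU, hW, hinv]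
    by_cases hn : n = j
    · subst hn; simp [hij, hij.symm]
    · by_cases hn' : n = i
      · subst hn'; simp [hij]
      · simp [hn, hn']
  refine ⟨(continuous_coordRotation i j hθ).measurable, ?_⟩
  have hm := (continuous_coordRotation i j hθ).measurable
  calc (gaussianSeq v).map (coordRotation i j θ)
      = (((gaussianSeq v).prod (γ.prod γ)).map U).map (coordRotation i j θ) := by
        rw [hUmp.map_eq]
    _ = ((gaussianSeq v).prod (γ.prod γ)).map (U ∘ W) := by
        rw [Measure.map_map hm hUmp.measurable, hcomm]
    _ = gaussianSeq v := (hUmp.comp hWmp).map_eq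

/-- One plus the energy carried by the modes below `N`. -/
def modeEnergy (N : ℕ) (x : ℕ → ℝ) : ℝ := 1 + ∑ i ∈ Finset.range N, x i ^ 2

theorem one_le_modeEnergy (N : ℕ) (x : ℕ → ℝ) : 1 ≤ modeEnergy N x := by
  unfold modeEnergy
  have : 0 ≤ ∑ i ∈ Finset.range N, x i ^ 2 := Finset.sum_nonneg fun i _ => sq_nonneg _
  linarith

theorem one_add_sq_le_modeEnergy {N i : ℕ} (hi : i < N) (x : ℕ → ℝ) :
    1 + x i ^ 2 ≤ modeEnergy N x := by
  unfold modeEnergy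
  have := Finset.single_le_sum (f := fun i => x i ^ 2) (fun i _ => sq_nonneg _)
    (Finset.mem_range.2 hi)
  linarith

theorem abs_le_modeEnergy {N i : ℕ} (hi : i < N) (x : ℕ → ℝ) : |x i| ≤ modeEnergy N x := by
  have h := one_add_sq_le_modeEnergy hi x
  rw [abs_le]
  constructor <;> nlinarith [sq_nonneg (x i - 1), sq_nonneg (x i + 1)]

theorem abs_mul_abs_le_modeEnergy {N i j : ℕ} (hi : i < N) (hj : j < N) (x : ℕ → ℝ) :
    |x i| * |x j| ≤ modeEnergy N x := by
  have h := one_add_sq_le_modeEnergy hi x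
  have h' := one_add_sq_le_modeEnergy hj x
  nlinarith [sq_nonneg (|x i| - |x j|), sq_abs (x i), sq_abs (x j)]

theorem modeEnergy_coordRotation {N i j : ℕ} (hij : i ≠ j) (hi : i < N) (hj : j < N)
    (θ : (ℕ → ℝ) → ℝ) (x : ℕ → ℝ) :
    modeEnergy N (coordRotation i j θ x) = modeEnergy N x := by
  unfold modeEnergy coordRotation
  set c := Real.cos (θ x)
  set s := Real.sin (θ x)
  have hcs : s ^ 2 + c ^ 2 = 1 := Real.sin_sq_add_cos_sq _
  have h : ∀ n, (if n = i then c * x i + s * x j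
      else if n = j then -s * x i + c * x j else x n) ^ 2
      = x n ^ 2 + (if n = i then (c * x i + s * x j) ^ 2 - x i ^ 2 else 0)
        + (if n = j then (-s * x i + c * x j) ^ 2 - x j ^ 2 else 0) := by
    intro n
    by_cases h1 : n = i
    · subst h1; simp [hij]
    · by_cases h2 : n = j
      · subst h2; simp [h1]
      · simp [h1, h2]
  simp only [h, Finset.sum_add_distrib, Finset.sum_ite_eq', Finset.mem_range, hi, hj, if_true]
  linear_combination (x i ^ 2 + x j ^ 2) * hcs

/-- `φ h` is a family of continuous maps preserving `μ` and the energy of the modes below `N`,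
which approximates the flow of the quadratic vector field `F` to first order in `h`. -/
structure IsFirstOrderFlow (μ : Measure (ℕ → ℝ)) (N : ℕ) (φ : ℝ → (ℕ → ℝ) → ℕ → ℝ)
    (F : (ℕ → ℝ) → ℕ → ℝ) : Prop where
  measurePreserving : ∀ h, MeasurePreserving (φ h) μ μ
  continuous : ∀ h, Continuous (φ h)
  energy : ∀ h x, modeEnergy N (φ h x) = modeEnergy N x
  bound : ∃ C, 0 ≤ C ∧ (∀ h x n, |φ h x n - x n| ≤ C * |h| * modeEnergy N x) ∧
    (∀ h x n, |φ h x n - x n - h * F x n| ≤ C * h ^ 2 * modeEnergy N x ^ 2) ∧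
    ∀ x y d, modeEnergy N y = modeEnergy N x → (∀ n, |y n - x n| ≤ d) →
      ∀ n, |F y n - F x n| ≤ C * modeEnergy N x * d

theorem IsFirstOrderFlow.id (μ : Measure (ℕ → ℝ)) (N : ℕ) :
    IsFirstOrderFlow μ N (fun _ x => x) (fun _ _ => 0) where
  measurePreserving _ := MeasurePreserving.id μ
  continuous _ := continuous_id
  energy _ _ := rfl
  bound := ⟨0, le_rfl, by simp, by simp, by simp⟩

theorem IsFirstOrderFlow.comp {μ : Measure (ℕ → ℝ)} {N : ℕ} {φ ψ : ℝ → (ℕ → ℝ) → ℕ → ℝ}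
    {F G : (ℕ → ℝ) → ℕ → ℝ} (hψ : IsFirstOrderFlow μ N ψ G) (hφ : IsFirstOrderFlow μ N φ F) :
    IsFirstOrderFlow μ N (fun h x => ψ h (φ h x)) (fun x n => F x n + G x n) where
  measurePreserving h := (hψ.measurePreserving h).comp (hφ.measurePreserving h)
  continuous h := (hψ.continuous h).comp (hφ.continuous h)
  energy h x := (hψ.energy h _).trans (hφ.energy h x)
  bound := by
    obtain ⟨C, hC, h1, h2, h3⟩ := hφ.bound
    obtain ⟨D, hD, g1, g2, g3⟩ := hψ.bound
    refine ⟨C + D + C * D, by positivity, fun h x n => ?_, fun h x n => ?_, ?_⟩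
    · have a := h1 h x n
      have b := g1 h (φ h x) n
      rw [hφ.energy] at b
      have hE := one_le_modeEnergy N x
      have : 0 ≤ C * D * |h| * modeEnergy N x := by positivity
      calc |ψ h (φ h x) n - x n| = |(ψ h (φ h x) n - φ h x n) + (φ h x n - x n)| := by ring_nf
        _ ≤ |ψ h (φ h x) n - φ h x n| + |φ h x n - x n| := abs_add_le _ _
        _ ≤ _ := by linarith
    · have a := h2 h x n
      have b := g2 h (φ h x) n
      rw [hφ.energy] at b
      have c := g3 x (φ h x) _ (hφ.energy h x) (h1 h x) n
      have e : |h * (G (φ h x) n - G x n)| ≤ C * D * h ^ 2 * modeEnergy N x ^ 2 := by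
        rw [abs_mul]
        calc |h| * |G (φ h x) n - G x n|
            ≤ |h| * (D * modeEnergy N x * (C * |h| * modeEnergy N x)) := by gcongr
          _ = C * D * |h| ^ 2 * modeEnergy N x ^ 2 := by ring
          _ = _ := by rw [sq_abs]
      calc |ψ h (φ h x) n - x n - h * (F x n + G x n)|
          = |(ψ h (φ h x) n - φ h x n - h * G (φ h x) n) + (φ h x n - x n - h * F x n)
              + h * (G (φ h x) n - G x n)| := by ring_nf
        _ ≤ |ψ h (φ h x) n - φ h x n - h * G (φ h x) n| + |φ h x n - x n - h * F x n|
              + |h * (G (φ h x) n - G x n)| := abs_add_three _ _ _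
        _ ≤ _ := by linarith
    · intro x y d hxy hd n
      have a := h3 x y d hxy hd n
      have b := g3 x y d hxy hd n
      have hE := one_le_modeEnergy N x
      have hd0 : 0 ≤ d := (abs_nonneg _).trans (hd 0)
      have : 0 ≤ C * D * modeEnergy N x * d := by positivity
      calc |F y n + G y n - (F x n + G x n)| = |(F y n - F x n) + (G y n - G x n)| := by ring_nf
        _ ≤ |F y n - F x n| + |G y n - G x n| := abs_add_le _ _
        _ ≤ _ := by linarith

theorem IsFirstOrderFlow.conj {μ : Measure (ℕ → ℝ)} {N : ℕ} {φ : ℝ → (ℕ → ℝ) → ℕ → ℝ}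
    {F : (ℕ → ℝ) → ℕ → ℝ} (hφ : IsFirstOrderFlow μ N φ F) {S S' : (ℕ → ℝ) → ℕ → ℝ}
    (hS : MeasurePreserving S μ μ) (hS' : MeasurePreserving S' μ μ)
    (hSc : Continuous S) (hSc' : Continuous S')
    (hSe : ∀ x, modeEnergy N (S x) = modeEnergy N x)
    (hSe' : ∀ x, modeEnergy N (S' x) = modeEnergy N x)
    (hinv : ∀ x, S' (S x) = x)
    (hSsub : ∀ x y n, S x n - S y n = S (fun m => x m - y m) n)
    (hSlin : ∀ x y z a n, S' x n - S' y n - a * S' z n = S' (fun m => x m - y m - a * z m) n)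
    (hSb : ∀ x d, (∀ n, |x n| ≤ d) → ∀ n, |S x n| ≤ 2 * d)
    (hSb' : ∀ x d, (∀ n, |x n| ≤ d) → ∀ n, |S' x n| ≤ 2 * d) :
    IsFirstOrderFlow μ N (fun h x => S' (φ h (S x))) (fun x => S' (F (S x))) where
  measurePreserving h := hS'.comp ((hφ.measurePreserving h).comp hS)
  continuous h := hSc'.comp ((hφ.continuous h).comp hSc)
  energy h x := by rw [hSe', hφ.energy, hSe]
  bound := by
    obtain ⟨C, hC, h1, h2, h3⟩ := hφ.bound
    have hsub' : ∀ x y n, S' x n - S' y n = S' (fun m => x m - y m) n := fun x y n => by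
      simpa using hSlin x y y 0 n
    refine ⟨4 * C, by positivity, fun h x n => ?_, fun h x n => ?_, ?_⟩
    · have a := h1 h (S x)
      rw [hSe] at a
      have b := hSb' _ _ a n
      rw [← hsub', hinv] at b
      have hE := one_le_modeEnergy N x
      have : 0 ≤ C * |h| * modeEnergy N x := by positivity
      linarith
    · have a := h2 h (S x)
      rw [hSe] at a
      have b := hSb' _ _ a n
      rw [← hSlin, hinv] at b
      have hE := one_le_modeEnergy N x
      have : 0 ≤ C * h ^ 2 * modeEnergy N x ^ 2 := by positivity
      linarith
    · intro x y d hxy hd n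
      have a := hSb _ _ hd
      simp only [← hSsub] at a
      have b := h3 (S x) (S y) (2 * d) (by rw [hSe, hSe, hxy]) a
      have c := hSb' _ _ b n
      rw [← hsub', hSe] at c
      linarith

/-- Rotation of the modes `i`, `j` with angular velocity `w * x l`. -/
def shearField (i j l : ℕ) (w : ℝ) (x : ℕ → ℝ) : ℕ → ℝ :=
  fun n => if n = i then w * x l * x j else if n = j then -(w * x l * x i) else 0

theorem abs_sin_sub_le_two_mul_sq (t : ℝ) : |Real.sin t - t| ≤ 2 * t ^ 2 := by
  rcases le_or_gt |t| 1 with h | h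
  · rw [abs_sub_comm]
    refine (Real.abs_sub_sin_le t).trans ?_
    rw [← sq_abs t]
    nlinarith [abs_nonneg t, sq_nonneg |t|, mul_nonneg (sq_nonneg |t|) (sub_nonneg.2 h)]
  · have h1 : |Real.sin t - t| ≤ |Real.sin t| + |t| := abs_sub _ _
    have h2 : |Real.sin t| ≤ |t| := Real.abs_sin_le_abs
    rw [← sq_abs t]
    nlinarith

theorem abs_cos_sub_one_le_abs (t : ℝ) : |Real.cos t - 1| ≤ |t| := by
  simpa using Real.abs_cos_sub_cos_le t 0

theorem abs_cos_sub_one_le_sq (t : ℝ) : |Real.cos t - 1| ≤ t ^ 2 := by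
  rw [abs_le]
  constructor
  · nlinarith [Real.one_sub_sq_div_two_le_cos (x := t), sq_nonneg t]
  · nlinarith [Real.cos_le_one t, sq_nonneg t]

theorem isFirstOrderFlow_shear (v : NNReal) {N i j l : ℕ} (hij : i ≠ j) (hil : i ≠ l)
    (hjl : j ≠ l) (hi : i < N) (hj : j < N) (hl : l < N) (w : ℝ) :
    IsFirstOrderFlow (gaussianSeq v) N (fun h => coordRotation i j fun x => h * (w * x l))
      (shearField i j l w) where
  measurePreserving h := measurePreserving_coordRotation v hij (by fun_prop) (by
    intro x a b
    simp [Function.update_of_ne hil.symm, Function.update_of_ne hjl.symm])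
  continuous h := continuous_coordRotation i j (by fun_prop)
  energy h x := modeEnergy_coordRotation hij hi hj _ x
  bound := by
    have key1 : ∀ (p q : ℕ), p < N → q < N → ∀ (h : ℝ) (x : ℕ → ℝ) (e : ℝ), |e| = 1 →
        |(Real.cos (h * (w * x l)) - 1) * x p + e * Real.sin (h * (w * x l)) * x q|
          ≤ 2 * |w| * |h| * modeEnergy N x := by
      intro p q hp hq h x e he
      have a := abs_mul_abs_le_modeEnergy hl hp x
      have b := abs_mul_abs_le_modeEnergy hl hq x
      have hθ : |h * (w * x l)| = |h| * |w| * |x l| := by rw [abs_mul, abs_mul, mul_assoc]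
      have c1 := abs_cos_sub_one_le_abs (h * (w * x l))
      have c2 : |Real.sin (h * (w * x l))| ≤ |h * (w * x l)| := Real.abs_sin_le_abs
      rw [hθ] at c1 c2
      calc _ ≤ |Real.cos (h * (w * x l)) - 1| * |x p| + |Real.sin (h * (w * x l))| * |x q| := by
            refine (abs_add_le _ _).trans_eq ?_
            rw [abs_mul, abs_mul, abs_mul, he, one_mul]
        _ ≤ (|h| * |w| * |x l|) * |x p| + (|h| * |w| * |x l|) * |x q| := by gcongr
        _ = |h| * |w| * (|x l| * |x p|) + |h| * |w| * (|x l| * |x q|) := by ring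
        _ ≤ |h| * |w| * modeEnergy N x + |h| * |w| * modeEnergy N x := by gcongr
        _ = _ := by ring
    have key2 : ∀ (p q : ℕ), p < N → q < N → ∀ (h : ℝ) (x : ℕ → ℝ) (e : ℝ), |e| = 1 →
        |(Real.cos (h * (w * x l)) - 1) * x p
            + e * (Real.sin (h * (w * x l)) - h * (w * x l)) * x q|
          ≤ 3 * w ^ 2 * h ^ 2 * modeEnergy N x ^ 2 := by
      intro p q hp hq h x e he
      have a := abs_le_modeEnergy hp x
      have b := abs_le_modeEnergy hq x
      have hE := one_le_modeEnergy N x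
      have c := one_add_sq_le_modeEnergy hl x
      have c1 := abs_cos_sub_one_le_sq (h * (w * x l))
      have c2 := abs_sin_sub_le_two_mul_sq (h * (w * x l))
      have c3 : (h * (w * x l)) ^ 2 ≤ h ^ 2 * w ^ 2 * modeEnergy N x := by
        calc (h * (w * x l)) ^ 2 = h ^ 2 * w ^ 2 * x l ^ 2 := by ring
          _ ≤ _ := by gcongr; linarith
      calc _ ≤ |Real.cos (h * (w * x l)) - 1| * |x p|
              + |Real.sin (h * (w * x l)) - h * (w * x l)| * |x q| := by
            refine (abs_add_le _ _).trans_eq ?_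
            rw [abs_mul, abs_mul, abs_mul, he, one_mul]
        _ ≤ (h ^ 2 * w ^ 2 * modeEnergy N x) * modeEnergy N x
              + (2 * (h ^ 2 * w ^ 2 * modeEnergy N x)) * modeEnergy N x := by
            gcongr
            · exact c1.trans c3
            · linarith
        _ = _ := by ring
    have key3 : ∀ (p : ℕ), p < N → ∀ (x y : ℕ → ℝ) (d : ℝ), modeEnergy N y = modeEnergy N x →
        (∀ n, |y n - x n| ≤ d) → |w * y l * y p - w * x l * x p|
          ≤ 2 * |w| * modeEnergy N x * d := by
      intro p hp x y d hxy hd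
      have hd0 : 0 ≤ d := (abs_nonneg _).trans (hd 0)
      have a := abs_le_modeEnergy hl y
      rw [hxy] at a
      have b := abs_le_modeEnergy hp x
      calc _ = |w| * |y l * (y p - x p) + x p * (y l - x l)| := by rw [← abs_mul]; ring_nf
        _ ≤ |w| * (|y l| * |y p - x p| + |x p| * |y l - x l|) := by
            gcongr
            refine (abs_add_le _ _).trans_eq ?_
            rw [abs_mul, abs_mul]
        _ ≤ |w| * (modeEnergy N x * d + modeEnergy N x * d) := by
            have := one_le_modeEnergy N x
            gcongr
            · exact hd p
            · exact hd l
        _ = _ := by ring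
    refine ⟨2 * |w| + 3 * w ^ 2, by positivity, fun h x n => ?_, fun h x n => ?_, ?_⟩
    · have hE := one_le_modeEnergy N x
      have h0 : 0 ≤ 3 * w ^ 2 * |h| * modeEnergy N x := by positivity
      have h0' : 0 ≤ 2 * |w| * |h| * modeEnergy N x := by positivity
      rw [add_mul, add_mul]
      by_cases h1 : n = i
      · subst h1
        have := key1 n j hi hj h x 1 (by simp)
        simp only [coordRotation, if_true]
        refine le_trans (le_of_eq ?_) (this.trans (by linarith))
        ring_nf
      · by_cases h2 : n = j
        · subst h2
          have := key1 n i hj hi h x (-1) (by simp)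
          simp only [coordRotation, if_true, h1, if_false]
          refine le_trans (le_of_eq ?_) (this.trans (by linarith))
          ring_nf
        · simp only [coordRotation, h1, h2, if_false, sub_self, abs_zero]
          positivity
    · have hE := one_le_modeEnergy N x
      have h0 : 0 ≤ 2 * |w| * h ^ 2 * modeEnergy N x ^ 2 := by positivity
      have h0' : 0 ≤ 3 * w ^ 2 * h ^ 2 * modeEnergy N x ^ 2 := by positivity
      rw [add_mul, add_mul]
      by_cases h1 : n = i
      · subst h1
        have := key2 n j hi hj h x 1 (by simp)
        simp only [coordRotation, shearField, if_true]
        refine le_trans (le_of_eq ?_) (this.trans (by linarith))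
        ring_nf
      · by_cases h2 : n = j
        · subst h2
          have := key2 n i hj hi h x (-1) (by simp)
          simp only [coordRotation, shearField, if_true, h1, if_false]
          refine le_trans (le_of_eq ?_) (this.trans (by linarith))
          ring_nf
        · simp only [coordRotation, shearField, h1, h2, if_false, sub_self, mul_zero, abs_zero]
          positivity
    · intro x y d hxy hd n
      have hd0 : 0 ≤ d := (abs_nonneg _).trans (hd 0)
      have hE := one_le_modeEnergy N x
      have h0 : 0 ≤ 3 * w ^ 2 * modeEnergy N x * d := by positivity
      rw [add_mul, add_mul]
      by_cases h1 : n = i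
      · subst h1
        have := key3 j hj x y d hxy hd
        simp only [shearField, if_true]
        linarith
      · by_cases h2 : n = j
        · subst h2
          have := key3 i hi x y d hxy hd
          simp only [shearField, if_true, h1, if_false, neg_sub_neg]
          rw [abs_sub_comm]
          linarith
        · simp only [shearField, h1, h2, if_false, sub_self, abs_zero]
          positivity

/-- The energy-conserving, divergence-free interaction of the modes `m`, `m + 1`, `m + 2`. -/
def triadField (m : ℕ) (w : ℝ) (x : ℕ → ℝ) : ℕ → ℝ :=
  fun n => if n = m then -(w * x m * x (m + 1))
    else if n = m + 1 then w * (x m ^ 2 - x (m + 2) ^ 2)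
    else if n = m + 2 then w * x (m + 1) * x (m + 2) else 0

theorem abs_coordRotation_le (i j : ℕ) (a : ℝ) {x : ℕ → ℝ} {d : ℝ} (hd : ∀ n, |x n| ≤ d)
    (n : ℕ) : |coordRotation i j (fun _ => a) x n| ≤ 2 * d := by
  have hd0 : 0 ≤ d := (abs_nonneg _).trans (hd 0)
  have h : ∀ p q r s : ℝ, |p| ≤ 1 → |q| ≤ 1 → |r| ≤ d → |s| ≤ d → |p * r + q * s| ≤ 2 * d := by
    intro p q r s hp hq hr hs
    calc |p * r + q * s| ≤ |p| * |r| + |q| * |s| := by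
          rw [← abs_mul, ← abs_mul]; exact abs_add_le _ _
      _ ≤ 1 * d + 1 * d := by gcongr
      _ = 2 * d := by ring
  unfold coordRotation
  have hc := Real.abs_cos_le_one a
  have hs := Real.abs_sin_le_one a
  split_ifs
  · exact h _ _ _ _ hc hs (hd i) (hd j)
  · exact h _ _ _ _ (by rwa [abs_neg]) hc (hd i) (hd j)
  · linarith [hd n]

theorem coordRotation_neg_coordRotation {i j : ℕ} (hij : i ≠ j) (a : ℝ) (x : ℕ → ℝ) :
    coordRotation i j (fun _ => -a) (coordRotation i j (fun _ => a) x) = x := by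
  funext n
  have hcs := Real.sin_sq_add_cos_sq a
  by_cases h1 : n = i
  · subst h1
    simp only [coordRotation, if_true, Real.cos_neg, Real.sin_neg, hij.symm, if_false]
    linear_combination x n * hcs
  · by_cases h2 : n = j
    · subst h2
      simp only [coordRotation, if_true, Real.cos_neg, Real.sin_neg, h1, if_false]
      linear_combination x n * hcs
    · simp [coordRotation, h1, h2]

theorem IsFirstOrderFlow.conj_coordRotation {v : NNReal} {N : ℕ} {φ : ℝ → (ℕ → ℝ) → ℕ → ℝ}
    {F : (ℕ → ℝ) → ℕ → ℝ} (hφ : IsFirstOrderFlow (gaussianSeq v) N φ F) {i j : ℕ} (hij : i ≠ j)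
    (hi : i < N) (hj : j < N) (a : ℝ) :
    IsFirstOrderFlow (gaussianSeq v) N
      (fun h x => coordRotation i j (fun _ => -a) (φ h (coordRotation i j (fun _ => a) x)))
      (fun x => coordRotation i j (fun _ => -a) (F (coordRotation i j (fun _ => a) x))) := by
  refine hφ.conj (measurePreserving_coordRotation v hij continuous_const fun _ _ _ => rfl)
    (measurePreserving_coordRotation v hij continuous_const fun _ _ _ => rfl)
    (continuous_coordRotation i j continuous_const) (continuous_coordRotation i j continuous_const)
    (modeEnergy_coordRotation hij hi hj _) (modeEnergy_coordRotation hij hi hj _)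
    (coordRotation_neg_coordRotation hij a) (fun x y n => ?_) (fun x y z b n => ?_)
    (fun x d hd n => abs_coordRotation_le i j _ hd n)
    (fun x d hd n => abs_coordRotation_le i j _ hd n)
  all_goals
    unfold coordRotation
    split_ifs <;> ring

theorem exists_isFirstOrderFlow_triad (v : NNReal) {N m : ℕ} (hm : m + 2 < N) (w : ℝ) :
    ∃ φ, IsFirstOrderFlow (gaussianSeq v) N φ (triadField m w) := by
  have h1 := (isFirstOrderFlow_shear v (N := N) (i := m) (j := m + 1) (l := m + 2)
    (by omega) (by omega) (by omega) (by omega) (by omega) (by omega) w).conj_coordRotation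
    (i := m) (j := m + 2) (by omega) (by omega) (by omega) (Real.pi / 4)
  have h2 := (isFirstOrderFlow_shear v (N := N) (i := m + 2) (j := m + 1) (l := m)
    (by omega) (by omega) (by omega) (by omega) (by omega) (by omega) w).conj_coordRotation
    (i := m) (j := m + 2) (by omega) (by omega) (by omega) (Real.pi / 4)
  obtain ⟨φ, hφ⟩ : ∃ φ, IsFirstOrderFlow (gaussianSeq v) N φ _ := ⟨_, h2.comp h1⟩
  refine ⟨φ, ?_⟩
  convert hφ using 1
  funext x n
  have hsq : Real.sqrt 2 ^ 2 = 2 := Real.sq_sqrt (by norm_num)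
  by_cases ha : n = m
  · subst ha
    simp [triadField, coordRotation, shearField]
    ring_nf
    simp only [hsq]
    ring
  by_cases hb : n = m + 1
  · subst hb
    simp [triadField, coordRotation, shearField]
    ring_nf
    simp only [hsq]
    ring
  by_cases hc : n = m + 2
  · subst hc
    simp [triadField, coordRotation, shearField]
    ring_nf
    simp only [hsq]
    ring
  simp [triadField, coordRotation, shearField, ha, hb, hc]

/-- The right-hand side of the infinite mixed shell model. -/
noncomputable def shellField (lam : ℝ) (n : ℕ) (x : ℕ → ℝ) : ℝ :=
  mixedK lam n * x (n - 1) ^ 2 - mixedK lam (n + 1) * x n * x (n + 1)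
    - mixedK lam n * x (n + 1) ^ 2 + mixedK lam (n - 1) * x (n - 1) * x n

theorem sum_triadField_eq_shellField (lam : ℝ) {M n : ℕ} (hn : n < M) (x : ℕ → ℝ) :
    ∑ m ∈ Finset.range M, triadField m (mixedK lam (m + 1)) x n = shellField lam n x := by
  have hsplit : ∀ m, triadField m (mixedK lam (m + 1)) x n
      = (if m = n then -(mixedK lam (m + 1) * x m * x (m + 1)) else 0)
      + (if m + 1 = n then mixedK lam (m + 1) * (x m ^ 2 - x (m + 2) ^ 2) else 0)
      + (if m + 2 = n then mixedK lam (m + 1) * x (m + 1) * x (m + 2) else 0) := by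
    intro m
    unfold triadField
    split_ifs <;> first | omega | ring
  simp only [hsplit, Finset.sum_add_distrib]
  match n, hn with
  | 0, hn => simp [shellField, mixedK]
  | 1, hn =>
    simp only [Nat.add_eq_right, Finset.sum_ite_eq', Finset.mem_range]
    simp [shellField, mixedK, hn]
  | n + 2, hn =>
    simp only [Nat.add_right_cancel_iff, show ∀ m, (m + 1 = n + 2) = (m = n + 1) by
      intro m; simp, Finset.sum_ite_eq', Finset.mem_range, hn, show n + 1 < M by omega,
      show n < M by omega, if_true, shellField]
    simp only [show n + 2 - 1 = n + 1 by omega]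
    ring_nf

theorem exists_isFirstOrderFlow_galerkin (v : NNReal) (lam : ℝ) (M : ℕ) :
    ∃ φ, IsFirstOrderFlow (gaussianSeq v) (M + 2) φ
      (fun x n => ∑ m ∈ Finset.range M, triadField m (mixedK lam (m + 1)) x n) := by
  have h : ∀ J ≤ M, ∃ φ, IsFirstOrderFlow (gaussianSeq v) (M + 2) φ
      (fun x n => ∑ m ∈ Finset.range J, triadField m (mixedK lam (m + 1)) x n) := by
    intro J
    induction J with
    | zero => exact fun _ => ⟨_, by simpa using IsFirstOrderFlow.id (gaussianSeq v) (M + 2)⟩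
    | succ J ih =>
      intro hJ
      obtain ⟨φ, hφ⟩ := ih (by omega)
      obtain ⟨ψ, hψ⟩ := exists_isFirstOrderFlow_triad v (N := M + 2) (m := J) (by omega)
        (mixedK lam (J + 1))
      obtain ⟨χ, hχ⟩ : ∃ χ, IsFirstOrderFlow (gaussianSeq v) (M + 2) χ _ := ⟨_, hψ.comp hφ⟩
      exact ⟨χ, by simpa only [Finset.sum_range_succ] using hχ⟩
  exact h M le_rfl

theorem integrable_coord_pow_four (v : NNReal) (i : ℕ) :
    Integrable (fun x : ℕ → ℝ => x i ^ 4) (gaussianSeq v) := by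
  have h : Integrable (fun t : ℝ => t ^ 4) (gaussianReal 0 v) := by
    have := (memLp_id_gaussianReal (μ := 0) (v := v) 4).integrable_norm_pow (p := 4) (by norm_num)
    refine this.congr (Filter.Eventually.of_forall fun t => ?_)
    simp only [id, Real.norm_eq_abs]
    rw [← abs_pow, abs_of_nonneg (by positivity)]
  exact (measurePreserving_eval_infinitePi (fun _ : ℕ => gaussianReal 0 v)
    i).integrable_comp_of_integrable h

theorem memLp_two_coord_mul_coord (v : NNReal) (i j : ℕ) :
    MemLp (fun x : ℕ → ℝ => x i * x j) 2 (gaussianSeq v) := by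
  rw [memLp_two_iff_integrable_sq (by fun_prop)]
  refine ((integrable_coord_pow_four v i).add (integrable_coord_pow_four v j)).mono'
    (by fun_prop) (Filter.Eventually.of_forall fun x => ?_)
  rw [Real.norm_eq_abs, abs_of_nonneg (sq_nonneg _)]
  simp only [Pi.add_apply]
  nlinarith [sq_nonneg (x i ^ 2 - x j ^ 2), sq_nonneg (x i ^ 2), sq_nonneg (x j ^ 2)]

theorem integrable_coord (v : NNReal) (i : ℕ) :
    Integrable (fun x : ℕ → ℝ => x i) (gaussianSeq v) := by
  refine ((integrable_const 1).add (integrable_coord_pow_four v i)).mono'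
    (measurable_pi_apply i).aestronglyMeasurable (Filter.Eventually.of_forall fun x => ?_)
  simp only [Real.norm_eq_abs, Pi.add_apply]
  rw [abs_le]
  constructor <;> nlinarith [sq_nonneg (x i ^ 2 - 1 / 2), sq_nonneg (x i + 1 / 2),
    sq_nonneg (x i - 1 / 2)]

theorem memLp_two_modeEnergy (v : NNReal) (N : ℕ) :
    MemLp (modeEnergy N) 2 (gaussianSeq v) := by
  refine (memLp_const (1 : ℝ)).add (memLp_finsetSum (Finset.range N) fun i _ => ?_)
  simpa only [sq] using memLp_two_coord_mul_coord v i i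

theorem continuous_shellField (lam : ℝ) (n : ℕ) : Continuous (shellField lam n) := by
  unfold shellField; fun_prop

theorem memLp_two_shellField (v : NNReal) (lam : ℝ) (n : ℕ) :
    MemLp (shellField lam n) 2 (gaussianSeq v) := by
  have h := fun (c : ℝ) (i j : ℕ) => (memLp_two_coord_mul_coord v i j).const_mul c
  refine ((((h (mixedK lam n) (n - 1) (n - 1)).sub (h (mixedK lam (n + 1)) n (n + 1))).sub
    (h (mixedK lam n) (n + 1) (n + 1))).add (h (mixedK lam (n - 1)) (n - 1) n)).ae_eq
    (Filter.Eventually.of_forall fun x => ?_)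
  simp only [shellField, Pi.add_apply, Pi.sub_apply]
  ring

/-- A step of length `T / K` of an approximation scheme preserving the Gaussian measure. -/
theorem exists_approximate_step (v : NNReal) (lam : ℝ) {T : ℝ} (hT : 0 < T) (j : ℕ) :
    ∃ (Φ : (ℕ → ℝ) → ℕ → ℝ) (K : ℕ), 0 < K ∧ Continuous Φ ∧
      MeasurePreserving Φ (gaussianSeq v) (gaussianSeq v) ∧ T / K ≤ 1 / (j + 1) ∧
      ∀ n < j, ∫ x, |Φ x n - x n - T / K * shellField lam n x| ∂(gaussianSeq v)
        ≤ T / K * (1 / (j + 1)) := by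
  obtain ⟨φ, hφ⟩ := exists_isFirstOrderFlow_galerkin v lam j
  obtain ⟨C, hC, -, h2, -⟩ := hφ.bound
  set I := ∫ x, modeEnergy (j + 2) x ^ 2 ∂(gaussianSeq v)
  have hI : 0 ≤ I := integral_nonneg fun x => sq_nonneg _
  obtain ⟨K, hK⟩ := exists_nat_gt (T * (j + 1) * (1 + C * I))
  have hK0 : (0 : ℝ) < K := lt_trans (by positivity) hK
  have hsmall : T / K * (1 + C * I) ≤ 1 / (j + 1) := by
    rw [div_mul_eq_mul_div, div_le_div_iff₀ hK0 (by positivity)]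
    linarith
  have hh : 0 < T / K := by positivity
  refine ⟨φ (T / K), K, by exact_mod_cast hK0, hφ.continuous _, hφ.measurePreserving _, ?_, ?_⟩
  · have : 0 ≤ T / K * (C * I) := by positivity
    linarith
  · intro n hn
    calc ∫ x, |φ (T / K) x n - x n - T / K * shellField lam n x| ∂(gaussianSeq v)
        ≤ ∫ x, C * (T / K) ^ 2 * modeEnergy (j + 2) x ^ 2 ∂(gaussianSeq v) := by
          refine integral_mono_of_nonneg (Filter.Eventually.of_forall fun x => abs_nonneg _)
            ((memLp_two_modeEnergy v _).integrable_sq.const_mul _)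
            (Filter.Eventually.of_forall fun x => ?_)
          have := h2 (T / K) x n
          rwa [sum_triadField_eq_shellField lam hn] at this
      _ = T / K * (T / K * (C * I)) := by rw [integral_const_mul]; ring
      _ ≤ T / K * (1 / (j + 1)) := by gcongr; linarith

/-- The continuous path starting at `a` with slope `b k` on `[k h, (k + 1) h]` for `k < K`. -/
noncomputable def polygonalPath (h : ℝ) (K : ℕ) (a : ℝ) (b : ℕ → ℝ) (t : ℝ) : ℝ :=
  a + ∑ k ∈ Finset.range K, b k * (min t ((k + 1 : ℕ) * h) - min t (k * h))

theorem continuous_polygonalPath (h : ℝ) (K : ℕ) (a : ℝ) (b : ℕ → ℝ) :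
    Continuous (polygonalPath h K a b) := by
  unfold polygonalPath; fun_prop

theorem abs_polygonalPath_sub_le {h : ℝ} (hh : 0 ≤ h) (K : ℕ) (a : ℝ) (b : ℕ → ℝ) (s t : ℝ) :
    |polygonalPath h K a b t - polygonalPath h K a b s|
      ≤ (1 + h * ∑ k ∈ Finset.range K, b k ^ 2) / 2 * √|t - s| := by
  wlog hst : s < t generalizing s t
  · rcases eq_or_lt_of_le (not_lt.1 hst) with h1 | h1
    · simp [h1]
    · rw [abs_sub_comm, abs_sub_comm t]
      exact this t s h1
  rw [abs_of_pos (sub_pos.2 hst)]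
  set κ := √(t - s)
  have hκ : 0 < κ := Real.sqrt_pos.2 (sub_pos.2 hst)
  have hκ2 : κ ^ 2 = t - s := Real.sq_sqrt (sub_pos.2 hst).le
  set Δ : ℕ → ℝ := fun k => (min t ((k + 1 : ℕ) * h) - min t (k * h))
    - (min s ((k + 1 : ℕ) * h) - min s (k * h)) with hΔ
  have hmono : ∀ k : ℕ, (k : ℝ) * h ≤ (k + 1 : ℕ) * h := fun k => by push_cast; nlinarith
  have hΔ0 : ∀ k, 0 ≤ Δ k := by
    intro k
    have := hmono k
    simp only [hΔ]
    rcases le_total t (k * h) with h1 | h1 <;> rcases le_total t ((k + 1 : ℕ) * h) with h2 | h2 <;>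
    rcases le_total s (k * h) with h3 | h3 <;> rcases le_total s ((k + 1 : ℕ) * h) with h4 | h4 <;>
    simp only [min_eq_left, min_eq_right, h1, h2, h3, h4] <;> linarith
  have hΔh : ∀ k, Δ k ≤ h := by
    intro k
    have := hmono k
    have e : ((k + 1 : ℕ) : ℝ) * h = k * h + h := by push_cast; ring
    simp only [hΔ]
    rcases le_total t (k * h) with h1 | h1 <;> rcases le_total t ((k + 1 : ℕ) * h) with h2 | h2 <;>
    rcases le_total s (k * h) with h3 | h3 <;> rcases le_total s ((k + 1 : ℕ) * h) with h4 | h4 <;>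
    simp only [min_eq_left, min_eq_right, h1, h2, h3, h4] <;> linarith
  have hsum : ∑ k ∈ Finset.range K, Δ k ≤ κ ^ 2 := by
    simp only [hΔ, Finset.sum_sub_distrib]
    rw [← Finset.sum_sub_distrib, ← Finset.sum_sub_distrib,
      Finset.sum_range_sub (fun k : ℕ => min t (k * h)),
      Finset.sum_range_sub (fun k : ℕ => min s (k * h)), hκ2]
    have hK : 0 ≤ (K : ℝ) * h := by positivity
    simp only [Nat.cast_zero, zero_mul]
    rcases le_total t (K * h) with h1 | h1 <;> rcases le_total t 0 with h2 | h2 <;>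
    rcases le_total s (K * h) with h3 | h3 <;> rcases le_total s 0 with h4 | h4 <;>
    simp only [min_eq_left, min_eq_right, h1, h2, h3, h4] <;> linarith
  have hterm : ∀ k, |b k * Δ k| ≤ κ / 2 * (h * b k ^ 2) + Δ k / (2 * κ) := by
    intro k
    rw [abs_mul, abs_of_nonneg (hΔ0 k)]
    have h1 : |b k| ≤ κ / 2 * b k ^ 2 + 1 / (2 * κ) := by
      have : κ / 2 * b k ^ 2 + 1 / (2 * κ) - |b k| = (κ * |b k| - 1) ^ 2 / (2 * κ) := by
        rw [← sq_abs (b k)]; field_simp; ring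
      have : 0 ≤ (κ * |b k| - 1) ^ 2 / (2 * κ) := by positivity
      linarith
    calc |b k| * Δ k ≤ (κ / 2 * b k ^ 2 + 1 / (2 * κ)) * Δ k := by gcongr; exact hΔ0 k
      _ = κ / 2 * b k ^ 2 * Δ k + Δ k / (2 * κ) := by ring
      _ ≤ κ / 2 * b k ^ 2 * h + Δ k / (2 * κ) := by gcongr; exact hΔh k
      _ = _ := by ring
  calc |polygonalPath h K a b t - polygonalPath h K a b s|
      = |∑ k ∈ Finset.range K, b k * Δ k| := by
        unfold polygonalPath
        rw [add_sub_add_left_eq_sub, ← Finset.sum_sub_distrib]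
        simp only [hΔ, mul_sub]
    _ ≤ ∑ k ∈ Finset.range K, (κ / 2 * (h * b k ^ 2) + Δ k / (2 * κ)) :=
        (Finset.abs_sum_le_sum_abs _ _).trans (Finset.sum_le_sum fun k _ => hterm k)
    _ = κ / 2 * (h * ∑ k ∈ Finset.range K, b k ^ 2) + (∑ k ∈ Finset.range K, Δ k) / (2 * κ) := by
        rw [Finset.sum_add_distrib, ← Finset.mul_sum, ← Finset.mul_sum, Finset.sum_div]
    _ ≤ κ / 2 * (h * ∑ k ∈ Finset.range K, b k ^ 2) + κ ^ 2 / (2 * κ) := by gcongr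
    _ = _ := by field_simp; ring

theorem polygonalPath_natCast_mul {h : ℝ} (hh : 0 ≤ h) {k K : ℕ} (hk : k ≤ K) (a : ℝ)
    (b : ℕ → ℝ) : polygonalPath h K a b (k * h) = a + h * ∑ j ∈ Finset.range k, b j := by
  unfold polygonalPath
  have h1 : ∀ j : ℕ, b j * (min (k * h) ((j + 1 : ℕ) * h) - min (k * h) (j * h))
      = if j ∈ Finset.range k then h * b j else 0 := by
    intro j
    by_cases hj : j < k
    · have e1 : ((j + 1 : ℕ) : ℝ) * h ≤ k * h := by gcongr; exact hj
      have e2 : (j : ℝ) * h ≤ k * h := by gcongr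
      rw [if_pos (Finset.mem_range.2 hj), min_eq_right e1, min_eq_right e2]
      push_cast; ring
    · have e1 : (k : ℝ) * h ≤ (j + 1 : ℕ) * h := by gcongr; omega
      have e2 : (k : ℝ) * h ≤ j * h := by gcongr; omega
      rw [if_neg (by simpa using hj), min_eq_left e1, min_eq_left e2]
      ring
  simp only [h1]
  rw [Finset.sum_ite_mem, Finset.inter_eq_right.2 (Finset.range_subset_range.2 hk), Finset.mul_sum]

theorem abs_shellField_sub_le (lam : ℝ) (n : ℕ) {x y : ℕ → ℝ} {D M : ℝ}
    (hD : ∀ m ∈ ({n - 1, n, n + 1} : Finset ℕ), |y m - x m| ≤ D)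
    (hM : ∀ m ∈ ({n - 1, n, n + 1} : Finset ℕ), |x m| ≤ M) :
    |shellField lam n y - shellField lam n x|
      ≤ (2 * |mixedK lam n| + |mixedK lam (n + 1)| + |mixedK lam (n - 1)|)
        * (D * (2 * M + D)) := by
  have hD0 : 0 ≤ D := (abs_nonneg _).trans (hD n (by simp))
  have hM0 : 0 ≤ M := (abs_nonneg _).trans (hM n (by simp))
  have key : ∀ p ∈ ({n - 1, n, n + 1} : Finset ℕ), ∀ q ∈ ({n - 1, n, n + 1} : Finset ℕ), ∀ c : ℝ,
      |c * (y p * y q - x p * x q)| ≤ |c| * (D * (2 * M + D)) := by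
    intro p hp q hq c
    rw [abs_mul]
    gcongr
    calc |y p * y q - x p * x q|
        = |(y p - x p) * (y q - x q) + (y p - x p) * x q + x p * (y q - x q)| := by ring_nf
      _ ≤ |y p - x p| * |y q - x q| + |y p - x p| * |x q| + |x p| * |y q - x q| := by
          simp only [← abs_mul]; exact abs_add_three _ _ _
      _ ≤ D * D + D * M + M * D := by
          gcongr <;> first | exact hD _ ‹_› | exact hM _ ‹_›
      _ = _ := by ring
  have m1 : n - 1 ∈ ({n - 1, n, n + 1} : Finset ℕ) := by simp
  have m2 : n ∈ ({n - 1, n, n + 1} : Finset ℕ) := by simp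
  have m3 : n + 1 ∈ ({n - 1, n, n + 1} : Finset ℕ) := by simp
  have k1 := key _ m1 _ m1 (mixedK lam n)
  have k2 := key _ m2 _ m3 (mixedK lam (n + 1))
  have k3 := key _ m3 _ m3 (mixedK lam n)
  have k4 := key _ m1 _ m2 (mixedK lam (n - 1))
  have e : shellField lam n y - shellField lam n x
      = mixedK lam n * (y (n - 1) * y (n - 1) - x (n - 1) * x (n - 1))
      - mixedK lam (n + 1) * (y n * y (n + 1) - x n * x (n + 1))
      - mixedK lam n * (y (n + 1) * y (n + 1) - x (n + 1) * x (n + 1))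
      + mixedK lam (n - 1) * (y (n - 1) * y n - x (n - 1) * x n) := by
    unfold shellField; ring
  rw [e]
  rw [abs_le] at k1 k2 k3 k4 ⊢
  constructor <;> linarith

/-- The polygonal path attached to a discrete trajectory `z` of the shell model. -/
noncomputable def shellPath (lam h : ℝ) (K : ℕ) (z : ℕ → ℕ → ℝ) (n : ℕ) : ℝ → ℝ :=
  polygonalPath h K (z 0 n) fun k => shellField lam n (z k)

/-- The Hölder constant of the polygonal path attached to a discrete trajectory. -/
noncomputable def pathHolder (lam h : ℝ) (K : ℕ) (z : ℕ → ℕ → ℝ) (n : ℕ) : ℝ :=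
  (1 + h * ∑ k ∈ Finset.range K, shellField lam n (z k) ^ 2) / 2

/-- The accumulated consistency error of a discrete trajectory. -/
noncomputable def pathDefect (lam h : ℝ) (K : ℕ) (z : ℕ → ℕ → ℝ) (n : ℕ) : ℝ :=
  ∑ j ∈ Finset.range K, |z (j + 1) n - z j n - h * shellField lam n (z j)|

theorem pathHolder_nonneg (lam : ℝ) {h : ℝ} (hh : 0 ≤ h) (K : ℕ) (z : ℕ → ℕ → ℝ) (n : ℕ) :
    0 ≤ pathHolder lam h K z n := by
  have : 0 ≤ ∑ k ∈ Finset.range K, shellField lam n (z k) ^ 2 :=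
    Finset.sum_nonneg fun k _ => sq_nonneg _
  unfold pathHolder
  positivity

theorem pathDefect_nonneg (lam h : ℝ) (K : ℕ) (z : ℕ → ℕ → ℝ) (n : ℕ) :
    0 ≤ pathDefect lam h K z n := Finset.sum_nonneg fun _ _ => abs_nonneg _

theorem shellPath_zero (lam : ℝ) {h : ℝ} (hh : 0 ≤ h) (K : ℕ) (z : ℕ → ℕ → ℝ) (n : ℕ) :
    shellPath lam h K z n 0 = z 0 n := by
  have := polygonalPath_natCast_mul hh K.zero_le (z 0 n) fun k => shellField lam n (z k)
  simpa [shellPath] using this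

theorem abs_shellPath_sub_le (lam : ℝ) {h : ℝ} (hh : 0 ≤ h) (K : ℕ) (z : ℕ → ℕ → ℝ) (n : ℕ)
    (s t : ℝ) : |shellPath lam h K z n t - shellPath lam h K z n s|
      ≤ pathHolder lam h K z n * √|t - s| :=
  abs_polygonalPath_sub_le hh K _ _ s t

theorem abs_shellPath_sub_grid_le (lam : ℝ) {h : ℝ} (hh : 0 ≤ h) {k K : ℕ} (hk : k ≤ K)
    (z : ℕ → ℕ → ℝ) (n : ℕ) {s : ℝ} (hs : s ∈ Set.Icc (k * h) ((k + 1 : ℕ) * h)) :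
    |shellPath lam h K z n s - z k n|
      ≤ pathDefect lam h K z n + pathHolder lam h K z n * √h := by
  have h1 : |shellPath lam h K z n (k * h) - z k n| ≤ pathDefect lam h K z n := by
    rw [shellPath, polygonalPath_natCast_mul hh hk, abs_sub_comm]
    have e : z k n = z 0 n + ∑ j ∈ Finset.range k, (z (j + 1) n - z j n) := by
      rw [Finset.sum_range_sub (fun j => z j n)]; ring
    have e' : z k n - (z 0 n + h * ∑ j ∈ Finset.range k, shellField lam n (z j))
        = ∑ j ∈ Finset.range k, (z (j + 1) n - z j n - h * shellField lam n (z j)) := by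
      rw [Finset.sum_sub_distrib, ← Finset.mul_sum]
      linear_combination e
    rw [e']
    refine (Finset.abs_sum_le_sum_abs _ _).trans ?_
    exact Finset.sum_le_sum_of_subset_of_nonneg (Finset.range_subset_range.2 hk)
      fun _ _ _ => abs_nonneg _
  have h2 := abs_shellPath_sub_le lam hh K z n (k * h) s
  have h3 : √|s - k * h| ≤ √h := by
    apply Real.sqrt_le_sqrt
    rw [abs_of_nonneg (by linarith [hs.1])]
    have := hs.2
    push_cast at this
    linarith
  have h4 := mul_le_mul_of_nonneg_left h3 (pathHolder_nonneg lam hh K z n)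
  calc |shellPath lam h K z n s - z k n|
      = |(shellPath lam h K z n (k * h) - z k n)
          + (shellPath lam h K z n s - shellPath lam h K z n (k * h))| := by ring_nf
    _ ≤ _ := (abs_add_le _ _).trans (by linarith)

theorem abs_shellPath_residual_le (lam : ℝ) {h : ℝ} (hh : 0 ≤ h) (K : ℕ) (z : ℕ → ℕ → ℝ) (n : ℕ)
    {D M t : ℝ} (ht : t ∈ Set.Icc 0 (K * h))
    (hD : ∀ m ∈ ({n - 1, n, n + 1} : Finset ℕ),
      pathDefect lam h K z m + pathHolder lam h K z m * √h ≤ D)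
    (hM : ∀ m ∈ ({n - 1, n, n + 1} : Finset ℕ),
      |z 0 m| + pathHolder lam h K z m * √(K * h) ≤ M) :
    |shellPath lam h K z n t - shellPath lam h K z n 0
        - ∫ s in (0 : ℝ)..t, shellField lam n (fun m => shellPath lam h K z m s)|
      ≤ K * h * ((2 * |mixedK lam n| + |mixedK lam (n + 1)| + |mixedK lam (n - 1)|)
        * (D * (2 * M + D))) := by
  set q := (2 * |mixedK lam n| + |mixedK lam (n + 1)| + |mixedK lam (n - 1)|)
        * (D * (2 * M + D)) with hq
  have hcont : Continuous fun s => shellField lam n (fun m => shellPath lam h K z m s) :=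
    (continuous_shellField lam n).comp
      (continuous_pi fun m => continuous_polygonalPath _ _ _ _)
  have hhol := fun m => pathHolder_nonneg lam hh K z m
  have hdef := fun m => pathDefect_nonneg lam h K z m
  have hD0 : 0 ≤ D := le_trans (by have := hhol n; have := hdef n; positivity) (hD n (by simp))
  have hM0 : 0 ≤ M := le_trans (by have := hhol n; positivity) (hM n (by simp))
  have hq0 : 0 ≤ q := by positivity
  have hbound : ∀ k < K, ∀ s ∈ Set.Icc (k * h) ((k + 1 : ℕ) * h), 0 ≤ s → s ≤ K * h →
      |shellField lam n (z k) - shellField lam n (fun m => shellPath lam h K z m s)| ≤ q := by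
    intro k hk s hs hs0 hsK
    refine abs_shellField_sub_le lam n (fun m hm => ?_) fun m hm => ?_
    · rw [abs_sub_comm]
      exact (abs_shellPath_sub_grid_le lam hh hk.le z m hs).trans (hD m hm)
    · refine le_trans ?_ (hM m hm)
      have h1 := abs_shellPath_sub_le lam hh K z m 0 s
      rw [shellPath_zero lam hh, sub_zero, abs_of_nonneg hs0] at h1
      have h2 := mul_le_mul_of_nonneg_left (Real.sqrt_le_sqrt hsK) (hhol m)
      have h3 := abs_sub_abs_le_abs_sub (shellPath lam h K z m s) (z 0 m)
      linarith
  set a : ℕ → ℝ := fun k => min t (k * h) with ha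
  have ha0 : a 0 = 0 := by simp [ha, ht.1]
  have haK : a K = t := by simp [ha, ht.2]
  have hamono : ∀ k, a k ≤ a (k + 1) := fun k =>
    min_le_min_left _ (by push_cast; nlinarith)
  have hint : ∫ s in (0 : ℝ)..t, shellField lam n (fun m => shellPath lam h K z m s)
      = ∑ k ∈ Finset.range K, ∫ s in a k..a (k + 1),
        shellField lam n (fun m => shellPath lam h K z m s) := by
    rw [intervalIntegral.sum_integral_adjacent_intervals
      fun k _ => hcont.intervalIntegrable _ _, ha0, haK]
  have hpath : shellPath lam h K z n t - shellPath lam h K z n 0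
      = ∑ k ∈ Finset.range K, ∫ _ in a k..a (k + 1), shellField lam n (z k) := by
    rw [shellPath_zero lam hh, shellPath, polygonalPath, add_sub_cancel_left]
    refine Finset.sum_congr rfl fun k _ => ?_
    rw [intervalIntegral.integral_const, smul_eq_mul, mul_comm]
  rw [hint, hpath, ← Finset.sum_sub_distrib]
  calc _ ≤ ∑ k ∈ Finset.range K, q * (a (k + 1) - a k) := by
        refine (Finset.abs_sum_le_sum_abs _ _).trans (Finset.sum_le_sum fun k hk => ?_)
        rw [← intervalIntegral.integral_sub (by simp) (hcont.intervalIntegrable _ _),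
          ← abs_of_nonneg (sub_nonneg.2 (hamono k)), ← Real.norm_eq_abs]
        refine intervalIntegral.norm_integral_le_of_norm_le_const fun s hs => ?_
        rw [Set.uIoc_of_le (hamono k)] at hs
        have h1 : s ≤ t := hs.2.trans (min_le_left _ _)
        have h2 : s ≤ (k + 1 : ℕ) * h := hs.2.trans (min_le_right _ _)
        have h3 : k * h < s := (min_lt_iff.1 hs.1).resolve_left (not_lt.2 h1)
        have h4 : 0 ≤ k * h := by positivity
        exact hbound k (Finset.mem_range.1 hk) s ⟨h3.le, h2⟩ (h4.trans h3.le) (h1.trans ht.2)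
    _ = q * t := by rw [← Finset.mul_sum, Finset.sum_range_sub, ha0, haK, sub_zero]
    _ ≤ q * (K * h) := by gcongr; exact ht.2
    _ = _ := mul_comm _ _

/-- The paths all of whose components have a prescribed square-root Hölder constant and
bound at time `0` form a compact set. -/
theorem isCompact_setOf_sqrt_holder {T : ℝ} (hT : 0 ≤ T) (M : ℕ → ℝ) :
    IsCompact {ω : ℕ → C(Set.Icc (0 : ℝ) T, ℝ) | ∀ n, |ω n ⟨0, le_rfl, hT⟩| ≤ M n ∧
      ∀ s t, |ω n t - ω n s| ≤ M n * √|(t : ℝ) - s|} := by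
  have hpi : {ω : ℕ → C(Set.Icc (0 : ℝ) T, ℝ) | ∀ n, |ω n ⟨0, le_rfl, hT⟩| ≤ M n ∧
      ∀ s t, |ω n t - ω n s| ≤ M n * √|(t : ℝ) - s|}
      = Set.pi Set.univ fun n => {f : C(Set.Icc (0 : ℝ) T, ℝ) | |f ⟨0, le_rfl, hT⟩| ≤ M n ∧
          ∀ s t, |f t - f s| ≤ M n * √|(t : ℝ) - s|} := by
    ext ω
    simp
  rw [hpi]
  refine isCompact_univ_pi fun n => ArzelaAscoli.isCompact_of_equicontinuous _ ?_ ?_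
  · have himage : ContinuousMap.toFun '' {f : C(Set.Icc (0 : ℝ) T, ℝ) |
        |f ⟨0, le_rfl, hT⟩| ≤ M n ∧ ∀ s t, |f t - f s| ≤ M n * √|(t : ℝ) - s|}
        = {f : Set.Icc (0 : ℝ) T → ℝ |
          |f ⟨0, le_rfl, hT⟩| ≤ M n ∧ ∀ s t, |f t - f s| ≤ M n * √|(t : ℝ) - s|} := by
      ext f
      constructor
      · rintro ⟨g, hg, rfl⟩
        exact hg
      · rintro ⟨h0, hf⟩
        refine ⟨⟨f, ?_⟩, ⟨h0, hf⟩, rfl⟩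
        rw [continuous_iff_continuousAt]
        intro s
        rw [ContinuousAt, tendsto_iff_dist_tendsto_zero]
        have hlim : Filter.Tendsto (fun t : Set.Icc (0 : ℝ) T => M n * √|(t : ℝ) - s|)
            (nhds s) (nhds 0) := by
          have : Continuous fun t : Set.Icc (0 : ℝ) T => M n * √|(t : ℝ) - s| := by fun_prop
          simpa using this.tendsto s
        exact squeeze_zero (fun _ => dist_nonneg) (fun t => hf s t) hlim
    rw [himage]
    refine IsCompact.of_isClosed_subset
      (isCompact_univ_pi fun _ : Set.Icc (0 : ℝ) T =>
        isCompact_Icc (a := -(M n + M n * √T)) (b := M n + M n * √T)) ?_ ?_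
    · refine IsClosed.and (isClosed_le (by fun_prop) (by fun_prop)) ?_
      simp only [Set.ofPred_forall]
      exact isClosed_iInter fun s => isClosed_iInter fun t =>
        isClosed_le (by fun_prop) (by fun_prop)
    · rintro f ⟨h0, hf⟩ t -
      have hM : 0 ≤ M n := (abs_nonneg _).trans h0
      have ht : |f t - f ⟨0, le_rfl, hT⟩| ≤ M n * √T := by
        refine (hf ⟨0, le_rfl, hT⟩ t).trans (mul_le_mul_of_nonneg_left (Real.sqrt_le_sqrt ?_) hM)
        simpa [abs_of_nonneg t.2.1] using t.2.2
      rw [Set.mem_Icc, ← abs_le]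
      calc |f t| = |f ⟨0, le_rfl, hT⟩ + (f t - f ⟨0, le_rfl, hT⟩)| := by ring_nf
        _ ≤ _ := (abs_add_le _ _).trans (add_le_add h0 ht)
  · refine Metric.equicontinuous_of_continuity_modulus
      (fun d => M n * √d) ?_ _ fun s t f => ?_
    · have : Continuous fun d : ℝ => M n * √d := by fun_prop
      simpa using this.tendsto 0
    · rw [dist_comm]
      refine (f.2.2 s t).trans_eq ?_
      rw [dist_comm, Subtype.dist_eq, Real.dist_eq]

/-- A uniform bound on the means of the initial values and of the square-root Hölder constants
makes a family of random paths tight. -/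
theorem isTightMeasureSet_range_map_of_sqrt_holder {T : ℝ} (hT : 0 ≤ T)
    [MeasurableSpace C(Set.Icc (0 : ℝ) T, ℝ)] [BorelSpace C(Set.Icc (0 : ℝ) T, ℝ)]
    {Ω ι : Type*} [MeasurableSpace Ω]
    {μ : Measure Ω} [IsProbabilityMeasure μ] (Y : ι → Ω → ℕ → C(Set.Icc (0 : ℝ) T, ℝ))
    (hY : ∀ i, Measurable (Y i)) (f : ι → ℕ → Ω → ℝ) (hf : ∀ i n, Integrable (f i n) μ)
    (hf0 : ∀ i n ω, 0 ≤ f i n ω) (c : ℕ → ℝ) (hc : ∀ i n, ∫ ω, f i n ω ∂μ ≤ c n)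
    (hinit : ∀ i n ω, |Y i ω n ⟨0, le_rfl, hT⟩| ≤ f i n ω)
    (hholder : ∀ i n ω s t, |Y i ω n t - Y i ω n s| ≤ f i n ω * √|(t : ℝ) - s|) :
    IsTightMeasureSet (Set.range fun i => μ.map (Y i)) := by
  rw [isTightMeasureSet_iff_exists_isCompact_measure_compl_le]
  intro ε hε
  obtain ⟨δ, hδ, hδε⟩ := ENNReal.exists_pos_sum_of_countable hε.ne' ℕ
  refine ⟨_, isCompact_setOf_sqrt_holder hT fun n => (|c n| + 1) / δ n, ?_⟩
  rintro _ ⟨i, rfl⟩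
  rw [Measure.map_apply (hY i) (isCompact_setOf_sqrt_holder hT _).isClosed.measurableSet.compl]
  have hsub : Y i ⁻¹' {ω : ℕ → C(Set.Icc (0 : ℝ) T, ℝ) |
      ∀ n, |ω n ⟨0, le_rfl, hT⟩| ≤ (|c n| + 1) / δ n ∧
        ∀ s t, |ω n t - ω n s| ≤ (|c n| + 1) / δ n * √|(t : ℝ) - s|}ᶜ
      ⊆ ⋃ n, {ω | (|c n| + 1) / δ n ≤ f i n ω} := by
    intro ω hω
    by_contra hcon
    simp only [Set.mem_iUnion, Set.mem_ofPred_eq, not_exists, not_le] at hcon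
    exact hω fun n => ⟨(hinit i n ω).trans (hcon n).le, fun s t => (hholder i n ω s t).trans
      (mul_le_mul_of_nonneg_right (hcon n).le (Real.sqrt_nonneg _))⟩
  refine (measure_mono hsub).trans ((measure_iUnion_le _).trans
    ((ENNReal.tsum_le_tsum fun n => ?_).trans hδε.le))
  have hδn : (0 : ℝ) < δ n := hδ n
  have hmarkov := mul_meas_ge_le_integral_of_nonneg
    (Filter.Eventually.of_forall (hf0 i n)) (hf i n) ((|c n| + 1) / δ n)
  rw [← ENNReal.ofReal_coe_nnreal, ← ofReal_measureReal]
  refine ENNReal.ofReal_le_ofReal ?_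
  have hle : (|c n| + 1) / δ n * μ.real {ω | (|c n| + 1) / δ n ≤ f i n ω} ≤ |c n| + 1 :=
    hmarkov.trans ((hc i n).trans ((le_abs_self _).trans (by linarith)))
  have hpos : 0 < |c n| + 1 := by positivity
  rw [div_mul_eq_mul_div, div_le_iff₀ hδn] at hle
  exact le_of_mul_le_mul_left hle hpos

/-- A continuous functional whose truncated root has vanishing mean along a weakly convergent
family of laws vanishes almost surely under the limit law. -/
theorem ae_eq_zero_of_tendsto_integral_min_sqrt {S ι : Type*} [TopologicalSpace S]
    [MeasurableSpace S] [OpensMeasurableSpace S] {L : Filter ι} [L.NeBot]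
    {P : ι → ProbabilityMeasure S} {Q : ProbabilityMeasure S}
    (hP : Filter.Tendsto P L (nhds Q)) {F : S → ℝ} (hF : Continuous F)
    (hlim : Filter.Tendsto (fun i => ∫ ω, min 1 √|F ω| ∂(P i : Measure S)) L (nhds 0)) :
    ∀ᵐ ω ∂(Q : Measure S), F ω = 0 := by
  have hcont : Continuous fun ω => min 1 √|F ω| := by fun_prop
  have hnonneg : ∀ ω, 0 ≤ min 1 √|F ω| := fun ω => by positivity
  let g : BoundedContinuousFunction S ℝ :=
    BoundedContinuousFunction.ofNormedAddCommGroup _ hcont 1 fun ω => by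
      rw [Real.norm_eq_abs, abs_of_nonneg (hnonneg ω)]
      exact min_le_left _ _
  have hg := (ProbabilityMeasure.tendsto_iff_forall_integral_tendsto.1 hP) g
  have hzero : ∫ ω, g ω ∂(Q : Measure S) = 0 := tendsto_nhds_unique hg hlim
  have hae := (integral_eq_zero_iff_of_nonneg (μ := (Q : Measure S)) hnonneg (g.integrable _)).1 hzero
  filter_upwards [hae] with ω hω
  have hω' : min 1 √|F ω| = 0 := hω
  have : √|F ω| = 0 := by
    rcases min_choice (1 : ℝ) √|F ω| with h | h
    · linarith
    · rw [← h, hω']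
  simpa using (Real.sqrt_eq_zero (abs_nonneg _)).1 this

/-- The truncated root of a product of an `L¹`-small and an `L¹`-bounded random variable has
small mean. -/
theorem tendsto_integral_min_sqrt_of_le {Ω : Type*} [MeasurableSpace Ω] {μ : Measure Ω}
    [IsProbabilityMeasure μ] {R D M : ℕ → Ω → ℝ} {A B : ℝ} {δ : ℕ → ℝ} (hA : 0 ≤ A)
    (hD0 : ∀ j ω, 0 ≤ D j ω) (hM0 : ∀ j ω, 0 ≤ M j ω)
    (hD : ∀ j, Integrable (D j) μ) (hM : ∀ j, Integrable (M j) μ)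
    (hR : ∀ j ω, |R j ω| ≤ A * (D j ω * (2 * M j ω + D j ω)))
    (hδ0 : ∀ j, 0 < δ j) (hδ : Filter.Tendsto δ Filter.atTop (nhds 0))
    (hDδ : ∀ᶠ j in Filter.atTop, ∫ ω, D j ω ∂μ ≤ δ j) (hMB : ∀ j, ∫ ω, M j ω ∂μ ≤ B) :
    Filter.Tendsto (fun j => ∫ ω, min 1 √|R j ω| ∂μ) Filter.atTop (nhds 0) := by
  have hbound : Filter.Tendsto (fun j => √(δ j) * (B + δ j / 2) + A * √(δ j) / 2)
      Filter.atTop (nhds 0) := by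
    have hs : Filter.Tendsto (fun j => √(δ j)) Filter.atTop (nhds 0) := by
      simpa using hδ.sqrt
    simpa using (hs.mul ((hδ.div_const 2).const_add B)).add ((hs.const_mul A).div_const 2)
  refine squeeze_zero' (Filter.Eventually.of_forall fun j => integral_nonneg fun ω => ?_) ?_ hbound
  · show 0 ≤ min 1 √|R j ω|
    positivity
  filter_upwards [hDδ] with j hj
  set κ := √(δ j) with hκ
  have hκ0 : 0 < κ := Real.sqrt_pos.2 (hδ0 j)
  have hκ2 : κ * κ = δ j := Real.mul_self_sqrt (hδ0 j).le
  have hpt : ∀ ω, min 1 √|R j ω| ≤ κ * M j ω + (κ / 2 + A / (2 * κ)) * D j ω := by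
    intro ω
    refine (min_le_right _ _).trans (Real.sqrt_le_iff.2 ⟨?_, (hR j ω).trans ?_⟩)
    · have := hD0 j ω
      have := hM0 j ω
      positivity
    · have hamgm : 4 * (A * (D j ω * (2 * M j ω + D j ω)))
          ≤ (κ * (2 * M j ω + D j ω) + A / κ * D j ω) ^ 2 := by
        have h := sq_nonneg (κ * (2 * M j ω + D j ω) - A / κ * D j ω)
        have he : κ * (2 * M j ω + D j ω) * (A / κ * D j ω)
            = A * (D j ω * (2 * M j ω + D j ω)) := by field_simp
        nlinarith
      have he : κ * M j ω + (κ / 2 + A / (2 * κ)) * D j ω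
          = (κ * (2 * M j ω + D j ω) + A / κ * D j ω) / 2 := by field_simp; ring
      rw [he]
      linarith
  calc ∫ ω, min 1 √|R j ω| ∂μ
      ≤ ∫ ω, (κ * M j ω + (κ / 2 + A / (2 * κ)) * D j ω) ∂μ :=
        integral_mono_of_nonneg (Filter.Eventually.of_forall fun ω => by positivity)
          (((hM j).const_mul κ).add ((hD j).const_mul _)) (Filter.Eventually.of_forall hpt)
    _ = κ * ∫ ω, M j ω ∂μ + (κ / 2 + A / (2 * κ)) * ∫ ω, D j ω ∂μ := by
        rw [integral_add ((hM j).const_mul κ) ((hD j).const_mul _), integral_const_mul,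
          integral_const_mul]
    _ ≤ κ * B + (κ / 2 + A / (2 * κ)) * δ j := by
        gcongr
        exact hMB j
    _ = κ * (B + δ j / 2) + A * κ / 2 := by
        rw [← hκ2]
        field_simp
        ring

/-- The infinite system state at time `s` of a path on `[0, T]`, frozen outside `[0, T]`. -/
noncomputable def pathState {T : ℝ} (hT : 0 ≤ T) (ω : ℕ → C(Set.Icc (0 : ℝ) T, ℝ)) (s : ℝ)
    (m : ℕ) : ℝ :=
  ω m (Set.projIcc 0 T hT s)

theorem continuous_pathState {T : ℝ} (hT : 0 ≤ T) :
    Continuous fun p : (ℕ → C(Set.Icc (0 : ℝ) T, ℝ)) × ℝ => pathState hT p.1 p.2 := by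
  refine continuous_pi fun m => ?_
  have hproj : Continuous (Set.projIcc (0 : ℝ) T hT) := continuous_projIcc
  have hcomp : Continuous fun p : (ℕ → C(Set.Icc (0 : ℝ) T, ℝ)) × ℝ => p.1 m := by fun_prop
  exact hcomp.eval (hproj.comp continuous_snd)

/-- The defect of a path in the integrated `n`-th equation of the shell model at time `t`. -/
noncomputable def shellResidual (lam : ℝ) {T : ℝ} (hT : 0 ≤ T) (n : ℕ) (t : ℝ)
    (ω : ℕ → C(Set.Icc (0 : ℝ) T, ℝ)) : ℝ :=
  pathState hT ω t n - pathState hT ω 0 n - ∫ s in (0 : ℝ)..t, shellField lam n (pathState hT ω s)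

theorem continuous_shellResidual (lam : ℝ) {T : ℝ} (hT : 0 ≤ T) (n : ℕ) :
    Continuous fun p : (ℕ → C(Set.Icc (0 : ℝ) T, ℝ)) × ℝ => shellResidual lam hT n p.2 p.1 := by
  have hstate := continuous_pathState hT
  have hcoord : Continuous fun p : (ℕ → C(Set.Icc (0 : ℝ) T, ℝ)) × ℝ => pathState hT p.1 p.2 n :=
    (continuous_apply n).comp hstate
  have hint : Continuous fun p : (ℕ → C(Set.Icc (0 : ℝ) T, ℝ)) × ℝ =>
      ∫ s in (0 : ℝ)..p.2, shellField lam n (pathState hT p.1 s) := by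
    refine intervalIntegral.continuous_parametric_intervalIntegral_of_continuous ?_ continuous_snd
    exact (continuous_shellField lam n).comp
      (hstate.comp ((continuous_fst.comp continuous_fst).prodMk continuous_snd))
  exact (hcoord.sub (hcoord.comp (continuous_fst.prodMk continuous_const))).sub hint

/-- The random polygonal path obtained by iterating a map of the state space. -/
noncomputable def iteratePath (lam T h : ℝ) (K : ℕ) (Φ : (ℕ → ℝ) → ℕ → ℝ) (x : ℕ → ℝ) (n : ℕ) :
    C(Set.Icc (0 : ℝ) T, ℝ) where
  toFun t := shellPath lam h K (fun k => Φ^[k] x) n t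
  continuous_toFun := (continuous_polygonalPath h K _ _).comp continuous_subtype_val

theorem continuous_iteratePath (lam T h : ℝ) (K : ℕ) {Φ : (ℕ → ℝ) → ℕ → ℝ} (hΦ : Continuous Φ) :
    Continuous (iteratePath lam T h K Φ) := by
  refine continuous_pi fun n => ContinuousMap.continuous_of_continuous_uncurry _ ?_
  have hit : ∀ k, Continuous Φ^[k] := hΦ.iterate
  have hfield := fun k => (continuous_shellField lam n).comp (hit k)
  simp only [iteratePath, shellPath, polygonalPath, Function.uncurry_def, ContinuousMap.coe_mk]
  refine ((continuous_apply n).comp ((hit 0).comp continuous_fst)).add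
    (continuous_finsetSum _ fun k _ => ((hfield k).comp continuous_fst).mul ?_)
  fun_prop

theorem pathState_iteratePath (lam : ℝ) {T : ℝ} (hT : 0 ≤ T) (h : ℝ) (K : ℕ)
    (Φ : (ℕ → ℝ) → ℕ → ℝ) (x : ℕ → ℝ) {s : ℝ} (hs : s ∈ Set.Icc 0 T) (m : ℕ) :
    pathState hT (iteratePath lam T h K Φ x) s m = shellPath lam h K (fun k => Φ^[k] x) m s := by
  simp only [pathState, Set.projIcc_of_mem hT hs]
  rfl

theorem shellResidual_iteratePath (lam : ℝ) {T : ℝ} (hT : 0 ≤ T) (h : ℝ) (K : ℕ)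
    (Φ : (ℕ → ℝ) → ℕ → ℝ) (x : ℕ → ℝ) (n : ℕ) {t : ℝ} (ht : t ∈ Set.Icc 0 T) :
    shellResidual lam hT n t (iteratePath lam T h K Φ x)
      = shellPath lam h K (fun k => Φ^[k] x) n t - shellPath lam h K (fun k => Φ^[k] x) n 0
        - ∫ s in (0 : ℝ)..t,
          shellField lam n fun m => shellPath lam h K (fun k => Φ^[k] x) m s := by
  unfold shellResidual
  rw [pathState_iteratePath lam hT h K Φ x ht, pathState_iteratePath lam hT h K Φ x ⟨le_rfl, hT⟩]
  congr 1
  refine intervalIntegral.integral_congr fun s hs => ?_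
  rw [Set.uIcc_of_le ht.1] at hs
  refine congrArg (shellField lam n) (funext fun m => ?_)
  exact pathState_iteratePath lam hT h K Φ x ⟨hs.1, hs.2.trans ht.2⟩ m

theorem MeasureTheory.MeasurePreserving.integral_comp_of_integrable {α β : Type*}
    [MeasurableSpace α] [MeasurableSpace β] {μ : Measure α} {ν : Measure β} {Φ : α → β}
    (hΦ : MeasurePreserving Φ μ ν) {g : β → ℝ} (hg : Integrable g ν) :
    ∫ x, g (Φ x) ∂μ = ∫ y, g y ∂ν := by
  rw [← hΦ.map_eq] at hg ⊢
  exact (integral_map hΦ.aemeasurable hg.aestronglyMeasurable).symm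

theorem map_gaussianSeq_shift (v : NNReal) (m : ℕ) :
    (gaussianSeq v).map (fun x => fun i : Fin m => x ((i : ℕ) + 1))
      = Measure.pi fun _ : Fin m => gaussianReal 0 v := by
  rw [← Measure.infinitePi_eq_pi]
  exact Measure.map_infinitePi_infinitePi_of_inj (P := fun _ : ℕ => gaussianReal 0 v)
    (f := fun i : Fin m => (i : ℕ) + 1) fun a b hab => Fin.ext (by simpa using hab)

section Moments

variable {v : NNReal} {lam : ℝ} {Φ : (ℕ → ℝ) → ℕ → ℝ}

theorem integrable_pathHolder (hΦ : MeasurePreserving Φ (gaussianSeq v) (gaussianSeq v)) (h : ℝ)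
    (K m : ℕ) :
    Integrable (fun x => pathHolder lam h K (fun k => Φ^[k] x) m) (gaussianSeq v) := by
  have hsq := (memLp_two_shellField v lam m).integrable_sq
  exact ((integrable_const _).add ((integrable_finsetSum _ fun k _ =>
    (hΦ.iterate k).integrable_comp_of_integrable hsq).const_mul h)).div_const 2

theorem integral_pathHolder (hΦ : MeasurePreserving Φ (gaussianSeq v) (gaussianSeq v)) (h : ℝ)
    (K m : ℕ) :
    ∫ x, pathHolder lam h K (fun k => Φ^[k] x) m ∂gaussianSeq v
      = (1 + K * h * ∫ x, shellField lam m x ^ 2 ∂gaussianSeq v) / 2 := by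
  have hsq := (memLp_two_shellField v lam m).integrable_sq
  have hk : ∀ k, Integrable (fun x => shellField lam m (Φ^[k] x) ^ 2) (gaussianSeq v) :=
    fun k => (hΦ.iterate k).integrable_comp_of_integrable hsq
  have hsum : ∫ x, ∑ k ∈ Finset.range K, shellField lam m (Φ^[k] x) ^ 2 ∂gaussianSeq v
      = K * ∫ x, shellField lam m x ^ 2 ∂gaussianSeq v := by
    rw [integral_finsetSum _ fun k _ => hk k]
    simp [(hΦ.iterate _).integral_comp_of_integrable hsq]
  unfold pathHolder
  rw [integral_div, integral_add (integrable_const _)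
    ((integrable_finsetSum _ fun k _ => hk k).const_mul h), integral_const_mul, hsum]
  simp
  ring

theorem integrable_step_defect (hΦ : MeasurePreserving Φ (gaussianSeq v) (gaussianSeq v)) (h : ℝ)
    (m : ℕ) :
    Integrable (fun x => |Φ x m - x m - h * shellField lam m x|) (gaussianSeq v) :=
  ((((hΦ.integrable_comp_of_integrable (integrable_coord v m)).sub (integrable_coord v m)).sub
    (((memLp_two_shellField v lam m).integrable (by norm_num)).const_mul h))).abs

theorem integrable_pathDefect (hΦ : MeasurePreserving Φ (gaussianSeq v) (gaussianSeq v)) (h : ℝ)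
    (K m : ℕ) :
    Integrable (fun x => pathDefect lam h K (fun k => Φ^[k] x) m) (gaussianSeq v) := by
  refine integrable_finsetSum _ fun k _ => ?_
  simp only [Function.iterate_succ_apply']
  exact (hΦ.iterate k).integrable_comp_of_integrable (integrable_step_defect hΦ h m)

theorem integral_pathDefect (hΦ : MeasurePreserving Φ (gaussianSeq v) (gaussianSeq v)) (h : ℝ)
    (K m : ℕ) :
    ∫ x, pathDefect lam h K (fun k => Φ^[k] x) m ∂gaussianSeq v
      = K * ∫ x, |Φ x m - x m - h * shellField lam m x| ∂gaussianSeq v := by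
  have hstep := integrable_step_defect (lam := lam) hΦ h m
  unfold pathDefect
  simp only [Function.iterate_succ_apply']
  have hk : ∀ k, Integrable (fun x => |Φ (Φ^[k] x) m - Φ^[k] x m
      - h * shellField lam m (Φ^[k] x)|) (gaussianSeq v) :=
    fun k => (hΦ.iterate k).integrable_comp_of_integrable hstep
  rw [integral_finsetSum _ fun k _ => hk k]
  simp [(hΦ.iterate _).integral_comp_of_integrable hstep]

end Moments

/-- Along the polygonal paths of approximate, measure-preserving time steps, the residual of each
equation tends to zero in mean. -/
theorem tendsto_integral_min_sqrt_shellResidual {v : NNReal} {lam T : ℝ} (hT : 0 < T)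
    {Φ : ℕ → (ℕ → ℝ) → ℕ → ℝ} {K : ℕ → ℕ} (hK : ∀ j, 0 < K j)
    (hΦ : ∀ j, MeasurePreserving (Φ j) (gaussianSeq v) (gaussianSeq v))
    (hstep : ∀ j, T / K j ≤ 1 / ((j : ℝ) + 1))
    (hdef : ∀ j, ∀ n < j, ∫ x, |Φ j x n - x n - T / K j * shellField lam n x| ∂gaussianSeq v
      ≤ T / K j * (1 / ((j : ℝ) + 1))) (n : ℕ) {t : ℝ} (ht : t ∈ Set.Icc 0 T) :
    Filter.Tendsto (fun j => ∫ x, min 1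
      √|shellResidual lam hT.le n t (iteratePath lam T (T / K j) (K j) (Φ j) x)| ∂gaussianSeq v)
      Filter.atTop (nhds 0) := by
  set s : Finset ℕ := {n - 1, n, n + 1} with hs
  set c : ℕ → ℝ := fun m => (1 + T * ∫ x, shellField lam m x ^ 2 ∂gaussianSeq v) / 2 with hc
  have hc0 : ∀ m, 0 ≤ c m := fun m => by
    have : 0 ≤ ∫ x, shellField lam m x ^ 2 ∂gaussianSeq v := integral_nonneg fun x => sq_nonneg _
    simp only [hc]
    positivity
  have hKT : ∀ j, (K j : ℝ) * (T / K j) = T := fun j => by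
    have : (K j : ℝ) ≠ 0 := by exact_mod_cast (hK j).ne'
    field_simp
  have hh : ∀ j, 0 ≤ T / K j := fun j => by positivity
  have hholder : ∀ j m, ∫ x, pathHolder lam (T / K j) (K j) (fun k => (Φ j)^[k] x) m ∂gaussianSeq v
      = c m := fun j m => by rw [integral_pathHolder (hΦ j), hKT]
  have hHi := fun j m => integrable_pathHolder (lam := lam) (hΦ j) (T / K j) (K j) m
  have hDi := fun j m => integrable_pathDefect (lam := lam) (hΦ j) (T / K j) (K j) m
  have hxi := fun m => (integrable_coord v m).abs
  have hH0 : ∀ j m x, 0 ≤ pathHolder lam (T / K j) (K j) (fun k => (Φ j)^[k] x) m :=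
    fun j m x => pathHolder_nonneg lam (hh j) _ _ m
  have hD0 : ∀ j m x, 0 ≤ pathDefect lam (T / K j) (K j) (fun k => (Φ j)^[k] x) m :=
    fun j m x => pathDefect_nonneg lam _ _ _ m
  have hDHi : ∀ j m, Integrable (fun x => pathDefect lam (T / K j) (K j) (fun k => (Φ j)^[k] x) m
      + pathHolder lam (T / K j) (K j) (fun k => (Φ j)^[k] x) m * √(T / K j)) (gaussianSeq v) :=
    fun j m => (hDi j m).add ((hHi j m).mul_const _)
  have hxHi : ∀ j m, Integrable (fun x : ℕ → ℝ => |x m|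
      + pathHolder lam (T / K j) (K j) (fun k => (Φ j)^[k] x) m * √T) (gaussianSeq v) :=
    fun j m => (hxi m).add ((hHi j m).mul_const _)
  refine tendsto_integral_min_sqrt_of_le
    (D := fun j x => ∑ m ∈ s, (pathDefect lam (T / K j) (K j) (fun k => (Φ j)^[k] x) m
      + pathHolder lam (T / K j) (K j) (fun k => (Φ j)^[k] x) m * √(T / K j)))
    (M := fun j x => ∑ m ∈ s, (|x m|
      + pathHolder lam (T / K j) (K j) (fun k => (Φ j)^[k] x) m * √T))
    (A := T * (2 * |mixedK lam n| + |mixedK lam (n + 1)| + |mixedK lam (n - 1)|))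
    (B := ∑ m ∈ s, ((∫ x, |x m| ∂gaussianSeq v) + c m * √T))
    (δ := fun j => ∑ m ∈ s, (T * (1 / ((j : ℝ) + 1)) + c m * √(1 / ((j : ℝ) + 1))))
    (by positivity) (fun j x => Finset.sum_nonneg fun m _ => ?_)
    (fun j x => Finset.sum_nonneg fun m _ => ?_)
    (fun j => integrable_finsetSum _ fun m _ => hDHi j m)
    (fun j => integrable_finsetSum _ fun m _ => hxHi j m)
    (fun j x => ?_) (fun j => Finset.sum_pos (fun m _ => ?_) ⟨n, by simp [hs]⟩) ?_ ?_ fun j => ?_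
  · have := hH0 j m x
    have := hD0 j m x
    positivity
  · have := hH0 j m x
    positivity
  · rw [shellResidual_iteratePath lam hT.le _ _ _ _ n ht]
    have hres := abs_shellPath_residual_le lam (hh j) (K j) (fun k => (Φ j)^[k] x) n (t := t)
      (by rwa [hKT j])
      (D := ∑ m ∈ s, (pathDefect lam (T / K j) (K j) (fun k => (Φ j)^[k] x) m
        + pathHolder lam (T / K j) (K j) (fun k => (Φ j)^[k] x) m * √(T / K j)))
      (M := ∑ m ∈ s, (|x m| + pathHolder lam (T / K j) (K j) (fun k => (Φ j)^[k] x) m * √T))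
      (fun m hm => Finset.single_le_sum (f := fun m =>
          pathDefect lam (T / K j) (K j) (fun k => (Φ j)^[k] x) m
          + pathHolder lam (T / K j) (K j) (fun k => (Φ j)^[k] x) m * √(T / K j))
        (fun i _ => by have := hH0 j i x; have := hD0 j i x; positivity) hm)
      (fun m hm => by
        rw [hKT j]
        exact Finset.single_le_sum (f := fun m => |x m|
            + pathHolder lam (T / K j) (K j) (fun k => (Φ j)^[k] x) m * √T)
          (fun i _ => by have := hH0 j i x; positivity) hm)
    rw [hKT j] at hres
    refine hres.trans_eq ?_
    ring
  · have := hc0 m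
    positivity
  · have h1 : Filter.Tendsto (fun j : ℕ => 1 / ((j : ℝ) + 1)) Filter.atTop (nhds 0) :=
      tendsto_one_div_add_atTop_nhds_zero_nat
    have h2 : Filter.Tendsto (fun j : ℕ => √(1 / ((j : ℝ) + 1))) Filter.atTop (nhds 0) := by
      simpa using h1.sqrt
    simpa using tendsto_finsetSum s fun m _ => (h1.const_mul T).add (h2.const_mul (c m))
  · filter_upwards [Filter.eventually_gt_atTop (n + 1)] with j hj
    rw [integral_finsetSum _ fun m _ => hDHi j m]
    refine Finset.sum_le_sum fun m hm => ?_
    have hmj : m < j := by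
      simp only [hs, Finset.mem_insert, Finset.mem_singleton] at hm
      omega
    rw [integral_add (hDi j m) ((hHi j m).mul_const _), integral_mul_const, hholder,
      integral_pathDefect (hΦ j)]
    refine add_le_add ?_ (mul_le_mul_of_nonneg_left (Real.sqrt_le_sqrt (hstep j)) (hc0 m))
    refine (mul_le_mul_of_nonneg_left (hdef j m hmj) (Nat.cast_nonneg _)).trans_eq ?_
    rw [← mul_assoc, hKT j]
  · rw [integral_finsetSum _ fun m _ => hxHi j m]
    refine Finset.sum_le_sum fun m _ => ?_
    rw [integral_add (hxi m) ((hHi j m).mul_const _), integral_mul_const, hholder]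

/-- There is a law on path space with Gaussian initial values under which every integrated equation
of the shell model holds almost surely at each time. -/
theorem exists_shellModel_path_law (v : NNReal) (lam : ℝ) {T : ℝ} (hT : 0 < T)
    [MeasurableSpace C(Set.Icc (0 : ℝ) T, ℝ)] [BorelSpace C(Set.Icc (0 : ℝ) T, ℝ)] :
    ∃ Q : ProbabilityMeasure (ℕ → C(Set.Icc (0 : ℝ) T, ℝ)),
      (∀ m : ℕ, (Q : Measure (ℕ → C(Set.Icc (0 : ℝ) T, ℝ))).map
          (fun ω => fun i : Fin m => pathState hT.le ω 0 ((i : ℕ) + 1))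
        = Measure.pi fun _ : Fin m => gaussianReal 0 v) ∧
      ∀ n, ∀ t ∈ Set.Icc 0 T,
        ∀ᵐ ω ∂(Q : Measure (ℕ → C(Set.Icc (0 : ℝ) T, ℝ))), shellResidual lam hT.le n t ω = 0 := by
  choose Φ K hK hΦc hΦ hstep hdef using exists_approximate_step v lam hT
  have hKT : ∀ j, (K j : ℝ) * (T / K j) = T := fun j => by
    have : (K j : ℝ) ≠ 0 := by exact_mod_cast (hK j).ne'
    field_simp
  have hh : ∀ j, 0 ≤ T / K j := fun j => by positivity
  set Y := fun j => iteratePath lam T (T / K j) (K j) (Φ j) with hYdef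
  have hYc : ∀ j, Continuous (Y j) := fun j => continuous_iteratePath lam T _ _ (hΦc j)
  have hYm : ∀ j, Measurable (Y j) := fun j => (hYc j).measurable
  let P : ℕ → ProbabilityMeasure (ℕ → C(Set.Icc (0 : ℝ) T, ℝ)) := fun j =>
    ⟨(gaussianSeq v).map (Y j), Measure.isProbabilityMeasure_map (hYm j).aemeasurable⟩
  have hY0 : ∀ j x n, Y j x n ⟨0, le_rfl, hT.le⟩ = x n := fun j x n =>
    shellPath_zero lam (hh j) (K j) (fun k => (Φ j)^[k] x) n
  have htight : IsTightMeasureSet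
      {((ν : ProbabilityMeasure _) : Measure (ℕ → C(Set.Icc (0 : ℝ) T, ℝ))) |
        ν ∈ Set.range P} := by
    have himage : {((ν : ProbabilityMeasure _) : Measure (ℕ → C(Set.Icc (0 : ℝ) T, ℝ))) |
        ν ∈ Set.range P} = Set.range fun j => (gaussianSeq v).map (Y j) := by
      ext ν
      constructor
      · rintro ⟨_, ⟨j, rfl⟩, rfl⟩
        exact ⟨j, rfl⟩
      · rintro ⟨j, rfl⟩
        exact ⟨P j, ⟨j, rfl⟩, rfl⟩
    rw [himage]
    have hHi := fun j m => integrable_pathHolder (lam := lam) (hΦ j) (T / K j) (K j) m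
    have hxi := fun m => (integrable_coord v m).abs
    have hH0 : ∀ j m x, 0 ≤ pathHolder lam (T / K j) (K j) (fun k => (Φ j)^[k] x) m :=
      fun j m x => pathHolder_nonneg lam (hh j) _ _ m
    refine isTightMeasureSet_range_map_of_sqrt_holder hT.le Y hYm
      (fun j n x => |x n| + pathHolder lam (T / K j) (K j) (fun k => (Φ j)^[k] x) n)
      (fun j n => (hxi n).add (hHi j n)) (fun j n x => add_nonneg (abs_nonneg _) (hH0 j n x))
      (fun n => (∫ x, |x n| ∂gaussianSeq v)
        + (1 + T * ∫ x, shellField lam n x ^ 2 ∂gaussianSeq v) / 2)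
      (fun j n => ?_) (fun j n x => ?_) fun j n x s t => ?_
    · rw [integral_add (hxi n) (hHi j n), integral_pathHolder (hΦ j), hKT]
    · rw [hY0]
      exact le_add_of_nonneg_right (hH0 j n x)
    · exact (abs_shellPath_sub_le lam (hh j) (K j) (fun k => (Φ j)^[k] x) n s t).trans
        (mul_le_mul_of_nonneg_right (le_add_of_nonneg_left (abs_nonneg _)) (Real.sqrt_nonneg _))
  obtain ⟨Q, -, hQ⟩ := (isCompact_closure_of_isTightMeasureSet htight).ultrafilter_le_nhds
    ((Filter.hyperfilter ℕ).map P) (by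
      rw [Filter.le_principal_iff, Ultrafilter.coe_map, Filter.mem_map]
      exact Filter.univ_mem' fun j => subset_closure ⟨j, rfl⟩)
  have hlim : Filter.Tendsto P (Filter.hyperfilter ℕ : Filter ℕ) (nhds Q) := hQ
  refine ⟨Q, fun m => ?_, fun n t ht => ?_⟩
  · have hcont : Continuous fun ω : ℕ → C(Set.Icc (0 : ℝ) T, ℝ) =>
        fun i : Fin m => pathState hT.le ω 0 ((i : ℕ) + 1) := by
      have h := (continuous_pathState hT.le).comp
        (continuous_id.prodMk (continuous_const (y := (0 : ℝ))))
      exact continuous_pi fun i => (continuous_apply ((i : ℕ) + 1)).comp h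
    have hmap := ProbabilityMeasure.tendsto_map_of_tendsto_of_continuous P Q hlim hcont
    have hconst : ∀ j, (P j).map hcont.measurable.aemeasurable
        = ⟨Measure.pi fun _ : Fin m => gaussianReal 0 v, inferInstance⟩ := by
      intro j
      apply Subtype.ext
      show ((gaussianSeq v).map (Y j)).map _ = Measure.pi fun _ : Fin m => gaussianReal 0 v
      rw [Measure.map_map hcont.measurable (hYm j), ← map_gaussianSeq_shift]
      congr 1
      funext x i
      simpa [pathState, Set.projIcc_left] using hY0 j x (i + 1)
    simp only [hconst] at hmap
    have heq := tendsto_nhds_unique hmap tendsto_const_nhds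
    exact congrArg Subtype.val heq
  · have hcont : Continuous (shellResidual lam hT.le n t) :=
      (continuous_shellResidual lam hT.le n).comp (continuous_id.prodMk continuous_const)
    refine ae_eq_zero_of_tendsto_integral_min_sqrt hlim hcont ?_
    have hres := (tendsto_integral_min_sqrt_shellResidual hT hK hΦ hstep hdef n ht).mono_left
      (Nat.hyperfilter_le_atTop)
    refine hres.congr fun j => ?_
    have hmin : Continuous fun ω : ℕ → C(Set.Icc (0 : ℝ) T, ℝ) =>
        min 1 √|shellResidual lam hT.le n t ω| := by fun_prop
    exact (integral_map (hYm j).aemeasurable hmin.aestronglyMeasurable).symm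

/-- existence of a random solution of the infinite mixed shell model whose
initial datum has law `μ_r = ⊗_{n≥1} N(0,r²)` (the infinite product Gaussian measure,
expressed through all its finite-dimensional marginals, which determine it uniquely):
there are a probability space `(Ω',F',P')` and a jointly measurable
`X : Ω' × [0,T] → ℝ^{ℕ≥1}` such that `(X_n(·,0))_{n≥1}` has law `μ_r` and, for `P'`-a.e.
`ω`, `(X_n(ω,·))_{n≥1}` is a componentwise solution with initial condition
`(X_n(ω,0))_{n≥1}`. -/
theorem random_solution_exists (lam r T : ℝ) (hlam : 1 < lam) (hr : 0 < r) (hT : 0 < T) :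
    ∃ (Ω' : Type) (_ : MeasurableSpace Ω') (P' : Measure Ω'),
      IsProbabilityMeasure P' ∧
      ∃ X : Ω' → ℝ → ℕ → ℝ,
        Measurable (fun p : Ω' × ℝ => X p.1 p.2) ∧
        (∀ m : ℕ,
          Measure.map (fun ω => fun i : Fin m => X ω 0 ((i : ℕ) + 1)) P'
            = Measure.pi fun _ : Fin m => gaussianReal 0 (r ^ 2).toNNReal) ∧
        ∀ᵐ ω ∂P',
          IsCwShellSolution lam T (fun n => X ω 0 n) (fun n t => X ω t n) := by
  let : MeasurableSpace C(Set.Icc (0 : ℝ) T, ℝ) := borel _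
  have : BorelSpace C(Set.Icc (0 : ℝ) T, ℝ) := ⟨rfl⟩
  obtain ⟨Q, hinit, hres⟩ := exists_shellModel_path_law (r ^ 2).toNNReal lam hT
  have hcoord : ∀ n, Continuous fun p : (ℕ → C(Set.Icc (0 : ℝ) T, ℝ)) × ℝ =>
      pathState hT.le p.1 p.2 n := fun n =>
    (continuous_apply n).comp (continuous_pathState hT.le)
  refine ⟨ℕ → C(Set.Icc (0 : ℝ) T, ℝ), inferInstance, Q, inferInstance,
    fun ω t n => if n = 0 then 0 else pathState hT.le ω t n, ?_, fun m => ?_, ?_⟩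
  · refine measurable_pi_lambda _ fun n => ?_
    by_cases hn : n = 0
    · simp [hn]
    · simpa [hn] using (hcoord n).measurable
  · simpa using hinit m
  · have hae : ∀ᵐ ω ∂(Q : Measure (ℕ → C(Set.Icc (0 : ℝ) T, ℝ))), ∀ (n : ℕ) (q : ℚ),
        shellResidual lam hT.le n (Set.projIcc 0 T hT.le (q : ℝ)) ω = 0 :=
      ae_all_iff.2 fun n => ae_all_iff.2 fun q => hres n _ (Subtype.coe_prop _)
    filter_upwards [hae] with ω hω
    refine ⟨fun t => by simp, fun n hn => ?_⟩
    have hn0 : n ≠ 0 := by omega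
    refine ⟨?_, fun t ht => ?_⟩
    · simpa [hn0, Function.comp_def] using
        ((hcoord n).comp (continuous_const.prodMk continuous_id)).continuousOn
    · have hcont : Continuous fun t : ℝ =>
          shellResidual lam hT.le n (Set.projIcc 0 T hT.le t) ω :=
        (continuous_shellResidual lam hT.le n).comp
          (continuous_const.prodMk (continuous_subtype_val.comp
            (continuous_projIcc (h := hT.le))))
      have hzero := congrFun ((Rat.denseRange_cast (𝕜 := ℝ)).equalizer hcont continuous_const
        (funext fun q => hω n q)) t
      simp only [Set.projIcc_of_mem hT.le ht, shellResidual] at hzero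
      have hint : ∀ s, mixedK lam n * (if n - 1 = 0 then 0 else pathState hT.le ω s (n - 1)) ^ 2
          - mixedK lam (n + 1) * (if n = 0 then 0 else pathState hT.le ω s n)
            * (if n + 1 = 0 then 0 else pathState hT.le ω s (n + 1))
          - mixedK lam n * (if n + 1 = 0 then 0 else pathState hT.le ω s (n + 1)) ^ 2
          + mixedK lam (n - 1) * (if n - 1 = 0 then 0 else pathState hT.le ω s (n - 1))
            * (if n = 0 then 0 else pathState hT.le ω s n)
          = shellField lam n (pathState hT.le ω s) := by
        intro s
        by_cases h1 : n = 1
        · subst h1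
          simp [shellField, mixedK]
        · have : n - 1 ≠ 0 := by omega
          simp [shellField, this, hn0]
      simp only [hint]
      simp only [hn0, if_false]
      linarith
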